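/- (Structure of near-extremizers of Vargas's estimate.) Assume BH(s,r) holds for some 3/2 < s < 2 and r < s'. Let Ω ⊆ [0,1]² be measurable with Ω = Ω(K) for some integer K ≥ 0 (i.e., every nonempty vertical fiber of Ω has 𝓗¹-measure in [2^{-K-1}, 2^{-K+1}]), let J ≥ 0 be an integer with 2^{-J-1} ≤ |π₁(Ω)| ≤ 2^{-J+1} where π₁(ξ) = ξ₁, and let ε ≲ 1 be the smallest dyadic number such that ∥𝓔χ_{Ω'}∥_{L^{2s}} ≤ ε|Ω|^{1/s'} for every measurable Ω' ⊆ Ω. Then there are admissible constants C, C' > 0 and a decomposition Ω = ⋃_{0 < δ ≤ ε, δ dyadic} Ω_δ into measurable sets such that for each dyadic δ ≤ ε: (i) Ω_δ is contained in a union of at most C' δ^{-C} tiles belonging to 𝓓_{J,K}, and (ii) for every measurable Ω' ⊆ Ω_δ, ∥𝓔χ_{Ω'}∥_{L^{2s}} ≤ C' δ |Ω|^{1/s'}. -/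

import Mathlib

open MeasureTheory Set
open scoped ENNReal

/-- The extension operator for the hyperbolic paraboloid `τ = ξ₁ξ₂` in `ℝ³`:
`𝓔f(t,x) = ∫_{ℝ²} e^{i(tξ₁ξ₂ + x·ξ)} f(ξ) dξ`. -/
noncomputable def extOp (f : ℝ × ℝ → ℂ) (p : ℝ × ℝ × ℝ) : ℂ :=
  ∫ ξ : ℝ × ℝ,
    Complex.exp (Complex.I * (p.1 * ξ.1 * ξ.2 + p.2.1 * ξ.1 + p.2.2 * ξ.2 : ℝ)) * f ξ

/-- Characteristic function of a set, valued in `ℂ`. -/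
noncomputable def chi (Ω : Set (ℝ × ℝ)) : ℝ × ℝ → ℂ := Ω.indicator fun _ => 1

/-- The axis-parallel unit square with lower-left corner `(a, b)`. -/
def unitSq (a b : ℝ) : Set (ℝ × ℝ) := Icc a (a + 1) ×ˢ Icc b (b + 1)

/-- Bilinear hypothesis BH(s,r) with constant `A`: a bilinear adjoint restriction estimate
`∥𝓔f·𝓔g∥_{L^s} ≤ A ∥f∥_{L^r} ∥g∥_{L^r}` whenever `f, g` are supported in `1 × 1`
axis-parallel squares whose projections onto each coordinate axis are separated by a
distance between `1` and `4` (equivalently, the corners satisfy `2 ≤ |aᵢ - bᵢ| ≤ 5`). -/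
def BH (s r A : ℝ) : Prop :=
  ∀ a₁ a₂ b₁ b₂ : ℝ, 2 ≤ |a₁ - b₁| → |a₁ - b₁| ≤ 5 → 2 ≤ |a₂ - b₂| → |a₂ - b₂| ≤ 5 →
    ∀ f g : ℝ × ℝ → ℂ,
      Function.support f ⊆ unitSq a₁ a₂ → Function.support g ⊆ unitSq b₁ b₂ →
      eLpNorm (fun p => extOp f p * extOp g p) (ENNReal.ofReal s) volume ≤
        ENNReal.ofReal A * eLpNorm f (ENNReal.ofReal r) volume *
          eLpNorm g (ENNReal.ofReal r) volume


/-- The dyadic interval `[m·2⁻ⁿ, (m+1)·2⁻ⁿ]`. -/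
def dyadicIcc (n m : ℤ) : Set ℝ := Icc ((m : ℝ) * 2 ^ (-n)) (((m : ℝ) + 1) * 2 ^ (-n))

/-- A tile in `𝓓_{j,k}`: a product of a dyadic interval of length `2⁻ʲ` with one of
length `2⁻ᵏ`. -/
def tile (j k m m' : ℤ) : Set (ℝ × ℝ) := dyadicIcc j m ×ˢ dyadicIcc k m'

/-- A dyadic number is one of the form `2ⁿ`, `n ∈ ℤ`. -/
def IsDyadic (x : ℝ) : Prop := ∃ n : ℤ, x = 2 ^ n

/-- The vertical fiber of `Ω ⊆ ℝ²` over `x`: `{η : (x, η) ∈ Ω}`. -/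
def vFiber (Ω : Set (ℝ × ℝ)) (x : ℝ) : Set ℝ := {y | (x, y) ∈ Ω}

/-- `Ω(K) = {ξ ∈ Ω : 2^{-K-1} ≤ 𝓗¹({η : (ξ₁,η) ∈ Ω}) ≤ 2^{-K+1}}`, the piece of `Ω` whose
vertical fibers have length about `2⁻ᴷ`. -/
noncomputable def fiberPiece (Ω : Set (ℝ × ℝ)) (K : ℕ) : Set (ℝ × ℝ) :=
  {ξ ∈ Ω | (2 : ℝ≥0∞) ^ (-(K : ℤ) - 1) ≤ volume (vFiber Ω ξ.1) ∧
    volume (vFiber Ω ξ.1) ≤ (2 : ℝ≥0∞) ^ (-(K : ℤ) + 1)}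

/-- `VargasBound s Ω c` says `∥𝓔χ_{Ω'}∥_{L^{2s}} ≤ c·|Ω|^{1/s'}` for every measurable
`Ω' ⊆ Ω` (here `1/s' = 1 - 1/s`). -/
def VargasBound (s : ℝ) (Ω : Set (ℝ × ℝ)) (c : ℝ) : Prop :=
  ∀ Ω' ⊆ Ω, MeasurableSet Ω' →
    eLpNorm (extOp (chi Ω')) (ENNReal.ofReal (2 * s)) volume ≤
      ENNReal.ofReal c * volume Ω ^ (1 - 1 / s)


open MeasureTheory Set
open scoped ENNReal

open FourierTransform SchwartzMap in
lemma exists_weight : ∃ (W : ℝ → ℝ) (c ρ C : ℝ), Continuous W ∧ 0 < c ∧ 0 < ρ ∧ 0 < C ∧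
    (∀ x, 0 ≤ W x) ∧ (∀ x, |x| ≤ ρ → c ≤ W x) ∧ (∀ x, W x ≤ C * ((1 + x ^ 2)⁻¹) ^ 2) ∧
    ∀ ω : ℝ, 1 ≤ |ω| → ∫ x : ℝ, (W x : ℂ) * Complex.exp (Complex.I * (x * ω : ℝ)) = 0 := by
  have key : ∀ ν : ℝ, ∃ b : 𝓢(ℝ, ℂ), ∀ x, b x =
      (((⟨1/40, 1/20, by norm_num, by norm_num⟩ : ContDiffBump (0 : ℝ)) (x - ν) : ℝ) : ℂ) := by
    intro ν
    set B : ContDiffBump (0 : ℝ) := ⟨1/40, 1/20, by norm_num, by norm_num⟩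
    have h1 : HasCompactSupport (fun x : ℝ => ((B (x - ν) : ℝ) : ℂ)) := by
      have := B.hasCompactSupport.comp_homeomorph (Homeomorph.subRight ν)
      exact this.comp_left (g := fun t : ℝ => (t : ℂ)) (by simp)
    have h2 : ContDiff ℝ ((⊤ : ℕ∞) : WithTop ℕ∞) (fun x : ℝ => ((B (x - ν) : ℝ) : ℂ)) := by
      have : ContDiff ℝ ((⊤ : ℕ∞) : WithTop ℕ∞) (fun x : ℝ => B (x - ν)) :=
        B.contDiff.comp (contDiff_id.sub contDiff_const)
      exact Complex.ofRealCLM.contDiff.comp this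
    exact ⟨h1.toSchwartzMap h2, fun x => rfl⟩
  obtain ⟨b, hb⟩ := key 0
  set B : ContDiffBump (0 : ℝ) := ⟨1/40, 1/20, by norm_num, by norm_num⟩ with hB
  set φ : 𝓢(ℝ, ℂ) := 𝓕 b with hφ
  have hφ0 : φ 0 ≠ 0 := by
    rw [hφ, SchwartzMap.fourier_coe, Real.fourier_eq]
    simp only [inner_zero_right, neg_zero, AddChar.map_zero_eq_one, one_smul]
    simp_rw [hb, sub_zero]
    have hi := integral_ofReal (μ := (volume : Measure ℝ)) (𝕜 := ℂ) (f := fun v : ℝ => B v)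
    refine ne_of_eq_of_ne hi ?_
    have hp : 0 < ∫ v : ℝ, B v := B.integral_pos
    exact Complex.ofReal_ne_zero.2 hp.ne'
  have hcont : Continuous (fun x => ‖φ x‖ ^ 2) := by fun_prop
  have hpos : 0 < ‖φ 0‖ ^ 2 := by positivity
  obtain ⟨ρ, hρ, hball⟩ := Metric.eventually_nhds_iff_ball.1
    (hcont.continuousAt.eventually_const_le (half_lt_self hpos))
  have hdec := SchwartzMap.one_add_le_sup_seminorm_apply (𝕜 := ℂ) (m := (2, 0)) (k := 2) (n := 0)
    le_rfl le_rfl φ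
  set S := (2 : ℝ) ^ (2, 0).1 * ((Finset.Iic (2, 0)).sup fun m => SchwartzMap.seminorm ℂ m.1 m.2) φ
  refine ⟨fun x => ‖φ x‖ ^ 2, ‖φ 0‖ ^ 2 / 2, ρ / 2, S ^ 2 + 1, hcont, by positivity, by positivity,
    by positivity, fun x => by positivity, ?_, ?_, ?_⟩
  · intro x hx
    exact hball x (by simp [Real.norm_eq_abs]; linarith)
  · intro x
    have h := hdec x
    rw [norm_iteratedFDeriv_zero, Real.norm_eq_abs] at h
    have h3 : 1 + x ^ 2 ≤ (1 + |x|) ^ 2 := by nlinarith [abs_nonneg x, sq_abs x]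
    have h4 : (1 + x ^ 2) * ‖φ x‖ ≤ S := le_trans (by gcongr) h
    have h5 : ((1 + x ^ 2) * ‖φ x‖) ^ 2 ≤ S ^ 2 := by gcongr
    have h6 : (0 : ℝ) < 1 + x ^ 2 := by positivity
    rw [inv_pow, ← div_eq_mul_inv, le_div_iff₀ (by positivity)]
    nlinarith
  · intro ω hω
    set ν : ℝ := -ω / (2 * Real.pi) with hν
    obtain ⟨b2, hb2⟩ := key ν
    have hpl := SchwartzMap.integral_inner_fourier_fourier b b2
    have hzero : ∀ x, inner ℂ (b x) (b2 x) = 0 := by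
      intro x
      rw [hb, hb2]
      by_cases hx : |x| < 1/20
      · have : B (x - ν) = 0 := by
          apply B.zero_of_le_dist
          have hpi := Real.pi_pos
          have hpi4 := Real.pi_lt_d2
          have hν1 : 1/10 ≤ |ν| := by
            rw [hν, abs_div, abs_neg, abs_of_pos (by positivity : 0 < 2 * Real.pi),
              le_div_iff₀ (by positivity)]
            linarith
          have := abs_sub_abs_le_abs_sub ν x
          rw [Real.dist_eq, sub_zero, abs_sub_comm]
          show (1/20 : ℝ) ≤ _
          linarith
        simp [this]
      · have : B (x - 0) = 0 := by
          apply B.zero_of_le_dist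
          rw [Real.dist_eq, sub_zero, sub_zero]
          show (1/20 : ℝ) ≤ _
          linarith
        rw [this]; simp
    simp_rw [hzero] at hpl
    rw [integral_zero] at hpl
    rw [← hpl]
    congr 1
    ext x
    have hsh : (𝓕 b2) x = Complex.exp (Complex.I * (x * ω : ℝ)) * (𝓕 b) x := by
      rw [SchwartzMap.fourier_coe, SchwartzMap.fourier_coe, Real.fourier_eq', Real.fourier_eq']
      simp only [hb2, hb, sub_zero]
      rw [← integral_const_mul, ← integral_add_right_eq_self _ ν]
      congr 1
      ext v
      simp only [add_sub_cancel_right, smul_eq_mul]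
      rw [← mul_assoc, ← Complex.exp_add]
      congr 2
      simp only [RCLike.inner_apply, conj_trivial, hν]
      have : (Real.pi : ℂ) ≠ 0 := by exact_mod_cast Real.pi_ne_zero
      push_cast
      field_simp
      ring
    rw [hsh, RCLike.inner_apply, mul_assoc, RCLike.mul_conj, mul_comm]
    norm_cast

open FourierTransform SchwartzMap in
lemma exists_repr : ∃ (ψ : ℝ → ℂ) (C : ℝ), Continuous ψ ∧ 0 < C ∧
    (∀ x, ‖ψ x‖ ≤ C * ((1 + x ^ 2)⁻¹) ^ 2) ∧
    ∀ ω : ℝ, |ω| ≤ 1 → ∫ x : ℝ, ψ x * Complex.exp (-(Complex.I * (x * ω : ℝ))) = 1 := by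
  set B : ContDiffBump (0 : ℝ) := ⟨1, 2, by norm_num, by norm_num⟩ with hB
  have h1 : HasCompactSupport (fun x : ℝ => ((B x : ℝ) : ℂ)) :=
    B.hasCompactSupport.comp_left (g := fun t : ℝ => (t : ℂ)) (by simp)
  have h2 : ContDiff ℝ ((⊤ : ℕ∞) : WithTop ℕ∞) (fun x : ℝ => ((B x : ℝ) : ℂ)) :=
    Complex.ofRealCLM.contDiff.comp B.contDiff
  set b : 𝓢(ℝ, ℂ) := h1.toSchwartzMap h2 with hb
  have hbx : ∀ x, b x = ((B x : ℝ) : ℂ) := fun x => rfl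
  set φ : 𝓢(ℝ, ℂ) := 𝓕⁻ b with hφ
  have hinv : 𝓕 φ = b := by rw [hφ]; exact FourierTransform.fourier_fourierInv_eq b
  have hdec := SchwartzMap.one_add_le_sup_seminorm_apply (𝕜 := ℂ) (m := (4, 0)) (k := 4) (n := 0)
    le_rfl le_rfl φ
  set S := (2 : ℝ) ^ (4, 0).1 * ((Finset.Iic (4, 0)).sup fun m => SchwartzMap.seminorm ℂ m.1 m.2) φ
  refine ⟨φ, |S| + 1, φ.continuous, by positivity, ?_, ?_⟩
  · intro x
    have h := hdec x
    rw [norm_iteratedFDeriv_zero, Real.norm_eq_abs] at h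
    have h3 : 1 + x ^ 2 ≤ (1 + |x|) ^ 2 := by nlinarith [abs_nonneg x, sq_abs x]
    have h3' : (1 + x ^ 2) ^ 2 ≤ (1 + |x|) ^ 4 := by
      calc (1 + x ^ 2) ^ 2 ≤ ((1 + |x|) ^ 2) ^ 2 := by gcongr
        _ = _ := by ring
    have h4 : (1 + x ^ 2) ^ 2 * ‖φ x‖ ≤ S := le_trans (by gcongr) h
    have h6 : (0 : ℝ) < 1 + x ^ 2 := by positivity
    rw [inv_pow, ← div_eq_mul_inv, le_div_iff₀ (by positivity)]
    linarith [le_abs_self S]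
  · intro ω hω
    have hval : (𝓕 φ) (ω / (2 * Real.pi)) = 1 := by
      rw [hinv, hbx, B.one_of_mem_closedBall]
      · simp
      · rw [Metric.mem_closedBall, Real.dist_eq, sub_zero, abs_div,
          abs_of_pos (by positivity : 0 < 2 * Real.pi), div_le_iff₀ (by positivity)]
        show |ω| ≤ 1 * _
        linarith [Real.pi_gt_three]
    rw [← hval, SchwartzMap.fourier_coe, Real.fourier_eq']
    congr 1
    ext x
    rw [smul_eq_mul, mul_comm]
    congr 2
    simp only [RCLike.inner_apply, conj_trivial]
    have : (Real.pi : ℂ) ≠ 0 := by exact_mod_cast Real.pi_ne_zero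
    push_cast
    field_simp

open MeasureTheory Set
open scoped ENNReal

/-- General oscillatory superposition with amplitude `a` and frequencies `(α, β)`. -/
noncomputable def osc {Z : Type*} [MeasurableSpace Z] (μ : Measure Z) (α β : Z → ℝ) (a : Z → ℂ)
    (x : ℝ × ℝ) : ℂ :=
  ∫ z, a z * Complex.exp (Complex.I * (x.1 * α z + x.2 * β z : ℝ)) ∂μ

lemma norm_expI (t : ℝ) : ‖Complex.exp (Complex.I * (t : ℂ))‖ = 1 := by
  rw [mul_comm]; exact Complex.norm_exp_ofReal_mul_I t

/-- The product decay weight. -/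
noncomputable def wt (x : ℝ × ℝ) : ℝ := (1 + x.1 ^ 2)⁻¹ * (1 + x.2 ^ 2)⁻¹

lemma wt_pos (x : ℝ × ℝ) : 0 < wt x := by unfold wt; positivity

lemma wt_le_one (x : ℝ × ℝ) : wt x ≤ 1 := by
  unfold wt
  have h1 : (1 + x.1 ^ 2)⁻¹ ≤ 1 := inv_le_one_of_one_le₀ (by nlinarith [sq_nonneg x.1])
  have h2 : (1 + x.2 ^ 2)⁻¹ ≤ 1 := inv_le_one_of_one_le₀ (by nlinarith [sq_nonneg x.2])
  exact mul_le_one₀ h1 (by positivity) h2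

lemma wt_cont : Continuous wt := by
  unfold wt
  have h1 : ∀ x : ℝ × ℝ, 1 + x.1 ^ 2 ≠ 0 := fun x => by positivity
  have h2 : ∀ x : ℝ × ℝ, 1 + x.2 ^ 2 ≠ 0 := fun x => by positivity
  fun_prop (disch := assumption)

lemma wt_integrable : Integrable wt volume := by
  unfold wt
  exact integrable_inv_one_add_sq.mul_prod integrable_inv_one_add_sq

lemma wt_sq_integrable : Integrable (fun x => wt x ^ 2) volume := by
  refine wt_integrable.mono' (wt_cont.pow 2).aestronglyMeasurable (Filter.Eventually.of_forall ?_)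
  intro x
  rw [Real.norm_of_nonneg (by positivity)]
  nlinarith [wt_pos x, wt_le_one x]

lemma wt_shift (x y : ℝ × ℝ) : wt x * wt y ≤ 4 * wt (x - y) := by
  have h : ∀ a b : ℝ, (1 + a ^ 2)⁻¹ * (1 + b ^ 2)⁻¹ ≤ 2 * (1 + (a - b) ^ 2)⁻¹ := by
    intro a b
    rw [← mul_inv, ← div_eq_mul_inv, inv_eq_one_div, div_le_div_iff₀ (by positivity) (by positivity)]
    nlinarith [sq_nonneg (a + b), sq_nonneg (a * b), sq_nonneg (a-b)]
  have h1 := h x.1 y.1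
  have h2 := h x.2 y.2
  unfold wt
  calc _ = ((1 + x.1 ^ 2)⁻¹ * (1 + y.1 ^ 2)⁻¹) * ((1 + x.2 ^ 2)⁻¹ * (1 + y.2 ^ 2)⁻¹) := by ring
    _ ≤ (2 * (1 + (x.1 - y.1) ^ 2)⁻¹) * (2 * (1 + (x.2 - y.2) ^ 2)⁻¹) := by gcongr
    _ = _ := by simp only [Prod.fst_sub, Prod.snd_sub]; ring

section
variable {Z : Type*} [MeasurableSpace Z] {μ : Measure Z} {α β : Z → ℝ}

lemma osc_phase_meas (hα : Measurable α) (hβ : Measurable β) (x : ℝ × ℝ) :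
    Measurable (fun z => Complex.exp (Complex.I * (x.1 * α z + x.2 * β z : ℝ))) := by
  fun_prop

lemma osc_norm_le (a : Z → ℂ) (x : ℝ × ℝ) : ‖osc μ α β a x‖ ≤ ∫ z, ‖a z‖ ∂μ := by
  unfold osc
  refine (norm_integral_le_integral_norm _).trans_eq ?_
  congr 1; ext z
  rw [norm_mul, norm_expI, mul_one]

lemma osc_cont (hα : Measurable α) (hβ : Measurable β) {a : Z → ℂ} (ha : Integrable a μ) :
    Continuous (osc μ α β a) := by
  unfold osc
  refine continuous_of_dominated (bound := fun z => ‖a z‖) ?_ ?_ ha.norm ?_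
  · intro x
    exact ha.aestronglyMeasurable.mul (osc_phase_meas hα hβ x).aestronglyMeasurable
  · intro x
    refine Filter.Eventually.of_forall fun z => ?_
    rw [norm_mul, norm_expI, mul_one]
  · refine Filter.Eventually.of_forall fun z => ?_
    fun_prop

lemma osc_shift (a : Z → ℂ) (x0 x : ℝ × ℝ) : osc μ α β a (x0 + x) =
    osc μ α β (fun z => a z * Complex.exp (Complex.I * (x0.1 * α z + x0.2 * β z : ℝ))) x := by
  unfold osc
  congr 1; ext z
  rw [mul_assoc, ← Complex.exp_add]
  congr 2
  simp only [Prod.fst_add, Prod.snd_add]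
  push_cast; ring

lemma osc_shift_integrable (hα : Measurable α) (hβ : Measurable β) {a : Z → ℂ}
    (ha : Integrable a μ) (x0 : ℝ × ℝ) :
    Integrable (fun z => a z * Complex.exp (Complex.I * (x0.1 * α z + x0.2 * β z : ℝ))) μ := by
  refine ha.mono (ha.aestronglyMeasurable.mul (osc_phase_meas hα hβ x0).aestronglyMeasurable) ?_
  refine Filter.Eventually.of_forall fun z => ?_
  rw [norm_mul, norm_expI, mul_one]

/-- Integrating an oscillatory superposition against an integrable kernel. -/
lemma osc_integral_kernel [SFinite μ] (hα : Measurable α) (hβ : Measurable β) {a : Z → ℂ}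
    (ha : Integrable a μ) {k : ℝ × ℝ → ℂ} (hk : Integrable k volume) (x : ℝ × ℝ) :
    ∫ y, k y * osc μ α β a (x - y) =
      ∫ z, (a z * Complex.exp (Complex.I * (x.1 * α z + x.2 * β z : ℝ))) *
        (∫ y : ℝ × ℝ, k y * Complex.exp (-(Complex.I * (y.1 * α z + y.2 * β z : ℝ)))) ∂μ := by
  unfold osc
  simp_rw [← integral_const_mul]
  rw [integral_integral_swap]
  · congr 1; ext z
    congr 1; ext y
    have : Complex.exp (Complex.I * ((x - y).1 * α z + (x - y).2 * β z : ℝ)) =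
        Complex.exp (Complex.I * (x.1 * α z + x.2 * β z : ℝ)) *
          Complex.exp (-(Complex.I * (y.1 * α z + y.2 * β z : ℝ))) := by
      rw [← Complex.exp_add]
      congr 1
      simp only [Prod.fst_sub, Prod.snd_sub]
      push_cast; ring
    rw [this]; ring
  · have h1 : Integrable (fun p : (ℝ × ℝ) × Z => k p.1 * a p.2) (volume.prod μ) := hk.mul_prod ha
    have hm : Measurable (fun p : (ℝ × ℝ) × Z =>
        Complex.exp (Complex.I * ((x - p.1).1 * α p.2 + (x - p.1).2 * β p.2 : ℝ))) := by
      fun_prop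
    refine h1.mono (((h1.aestronglyMeasurable.mul hm.aestronglyMeasurable)).congr
      (Filter.Eventually.of_forall fun p => ?_)) (Filter.Eventually.of_forall fun p => ?_)
    · simp [Function.uncurry, mul_assoc]
    · simp only [Function.uncurry]
      rw [norm_mul, norm_mul, norm_expI, mul_one, norm_mul]

lemma prod_kernel_integral (f g : ℝ → ℂ) (u v : ℝ) :
    ∫ y : ℝ × ℝ, (f y.1 * g y.2) * Complex.exp (-(Complex.I * (y.1 * u + y.2 * v : ℝ))) =
    (∫ y : ℝ, f y * Complex.exp (-(Complex.I * (y * u : ℝ)))) *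
      ∫ y : ℝ, g y * Complex.exp (-(Complex.I * (y * v : ℝ))) := by
  rw [← integral_prod_mul]
  congr 1; ext y
  rw [mul_mul_mul_comm, ← Complex.exp_add]
  congr 2
  push_cast; ring

lemma osc_reproduce [SFinite μ] (hα : Measurable α) (hβ : Measurable β) {a : Z → ℂ}
    (ha : Integrable a μ) {ψ : ℝ → ℂ} {C : ℝ} (hψc : Continuous ψ)
    (hψ : ∀ x, ‖ψ x‖ ≤ C * ((1 + x ^ 2)⁻¹) ^ 2)
    (hψ1 : ∀ ω : ℝ, |ω| ≤ 1 → ∫ x : ℝ, ψ x * Complex.exp (-(Complex.I * (x * ω : ℝ))) = 1)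
    (p q : ℝ) (hsupp : ∀ z, a z ≠ 0 → |α z - p| ≤ 1 ∧ |β z - q| ≤ 1) (x : ℝ × ℝ) :
    ‖osc μ α β a x‖ₑ ≤ ENNReal.ofReal (C ^ 2) *
      ∫⁻ y, ENNReal.ofReal (wt y ^ 2) * ‖osc μ α β a (x - y)‖ₑ := by
  set k : ℝ × ℝ → ℂ := fun y => (ψ y.1 * Complex.exp (Complex.I * (y.1 * p : ℝ))) *
    (ψ y.2 * Complex.exp (Complex.I * (y.2 * q : ℝ))) with hk
  have hkn : ∀ y, ‖k y‖ ≤ C ^ 2 * wt y ^ 2 := by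
    intro y
    simp only [hk, norm_mul, norm_expI, mul_one]
    calc ‖ψ y.1‖ * ‖ψ y.2‖ ≤ (C * ((1 + y.1 ^ 2)⁻¹) ^ 2) * (C * ((1 + y.2 ^ 2)⁻¹) ^ 2) :=
          mul_le_mul (hψ _) (hψ _) (norm_nonneg _) ((norm_nonneg _).trans (hψ _))
      _ = _ := by unfold wt; ring
  have hki : Integrable k volume := by
    refine (wt_sq_integrable.const_mul (C ^ 2)).mono' ?_ (Filter.Eventually.of_forall hkn)
    apply Continuous.aestronglyMeasurable
    fun_prop
  have hrep : osc μ α β a x = ∫ y, k y * osc μ α β a (x - y) := by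
    rw [osc_integral_kernel hα hβ ha hki]
    unfold osc
    congr 1; ext z
    by_cases hz : a z = 0
    · simp [hz]
    · obtain ⟨h1, h2⟩ := hsupp z hz
      rw [hk, prod_kernel_integral (fun y => ψ y * Complex.exp (Complex.I * (y * p : ℝ)))
        (fun y => ψ y * Complex.exp (Complex.I * (y * q : ℝ)))]
      have e : ∀ t r : ℝ, |t - r| ≤ 1 → ∫ y : ℝ, ψ y * Complex.exp (Complex.I * (y * r : ℝ)) *
          Complex.exp (-(Complex.I * (y * t : ℝ))) = 1 := by
        intro t r h
        rw [← hψ1 _ h]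
        congr 1; ext y
        rw [mul_assoc, ← Complex.exp_add]
        congr 2
        push_cast; ring
      rw [e _ _ h1, e _ _ h2]; simp
  conv_lhs => rw [hrep]
  refine (enorm_integral_le_lintegral_enorm _).trans ?_
  rw [← lintegral_const_mul' _ _ ENNReal.ofReal_ne_top]
  refine lintegral_mono fun y => ?_
  rw [enorm_mul, ← mul_assoc, ← ENNReal.ofReal_mul (by positivity)]
  gcongr
  rw [← ofReal_norm]
  exact ENNReal.ofReal_le_ofReal (hkn y)

/-- Orthogonality of oscillatory superpositions with separated frequencies against `W ⊗ W`. -/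
lemma osc_orth [SFinite μ] (hα : Measurable α) (hβ : Measurable β) {a a' : Z → ℂ}
    (ha : Integrable a μ) (ha' : Integrable a' μ) {W : ℝ → ℝ} {C : ℝ} (hWc : Continuous W)
    (hW0 : ∀ x, 0 ≤ W x)
    (hW : ∀ x, W x ≤ C * ((1 + x ^ 2)⁻¹) ^ 2)
    (hW1 : ∀ ω : ℝ, 1 ≤ |ω| → ∫ x : ℝ, (W x : ℂ) * Complex.exp (Complex.I * (x * ω : ℝ)) = 0)
    (hsep : (∀ z z', a z ≠ 0 → a' z' ≠ 0 → 1 ≤ |α z - α z'|) ∨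
      (∀ z z', a z ≠ 0 → a' z' ≠ 0 → 1 ≤ |β z - β z'|)) :
    ∫ x : ℝ × ℝ, ((W x.1 * W x.2 : ℝ) : ℂ) *
      (osc μ α β a x * (starRingEnd ℂ) (osc μ α β a' x)) = 0 := by
  -- the product is an oscillatory superposition over `Z × Z`
  have hprod : ∀ x, osc μ α β a x * (starRingEnd ℂ) (osc μ α β a' x) =
      osc (μ.prod μ) (fun z => α z.2 - α z.1) (fun z => β z.2 - β z.1)
        (fun z => a z.1 * (starRingEnd ℂ) (a' z.2)) (0 - x) := by
    intro x
    unfold osc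
    rw [← integral_conj, ← integral_prod_mul]
    congr 1; ext z
    rw [map_mul, ← Complex.exp_conj, mul_mul_mul_comm, ← Complex.exp_add]
    congr 2
    simp only [map_mul, Complex.conj_I, Complex.conj_ofReal, Prod.fst_sub, Prod.snd_sub,
      Prod.fst_zero, Prod.snd_zero]
    push_cast; ring
  have hki : Integrable (fun x : ℝ × ℝ => ((W x.1 * W x.2 : ℝ) : ℂ)) volume := by
    refine (wt_sq_integrable.const_mul (C ^ 2)).mono' ?_ (Filter.Eventually.of_forall fun y => ?_)
    · apply Continuous.aestronglyMeasurable
      fun_prop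
    · rw [Complex.norm_real, Real.norm_of_nonneg (mul_nonneg (hW0 _) (hW0 _))]
      calc W y.1 * W y.2 ≤ (C * ((1 + y.1 ^ 2)⁻¹) ^ 2) * (C * ((1 + y.2 ^ 2)⁻¹) ^ 2) :=
          mul_le_mul (hW _) (hW _) (hW0 _) ((hW0 _).trans (hW _))
        _ = _ := by unfold wt; ring
  simp_rw [hprod]
  have hconj : Integrable (fun z => (starRingEnd ℂ) (a' z)) μ :=
    (Complex.conjLIE.integrable_comp_iff).2 ha'
  rw [osc_integral_kernel (by fun_prop) (by fun_prop) (ha.mul_prod hconj) hki]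
  refine integral_eq_zero_of_ae (Filter.Eventually.of_forall fun z => ?_)
  by_cases h1 : a z.1 = 0
  · simp [h1]
  by_cases h2 : a' z.2 = 0
  · simp [h2]
  have e : ∀ u v : ℝ, 1 ≤ |u - v| →
      ∫ y : ℝ, (W y : ℂ) * Complex.exp (-(Complex.I * (y * (v - u) : ℝ))) = 0 := by
    intro u v h
    rw [← hW1 _ h]
    congr 1; ext y
    congr 2
    push_cast; ring
  simp only [Complex.ofReal_mul]
  have := prod_kernel_integral (fun y => (W y : ℂ)) (fun y => (W y : ℂ)) (α z.2 - α z.1) (β z.2 - β z.1)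
  simp only [Complex.ofReal_mul] at this
  rw [this]
  rcases hsep with h | h
  · have := e _ _ (h z.1 z.2 h1 h2)
    simp only [Complex.ofReal_mul] at this
    rw [this]; simp
  · have := e _ _ (h z.1 z.2 h1 h2)
    simp only [Complex.ofReal_mul] at this
    rw [this]; simp
end

open MeasureTheory Set
open scoped ENNReal

/-- The weight with values in `ℝ≥0∞`. -/
noncomputable def ww (x : ℝ × ℝ) : ℝ≥0∞ := ENNReal.ofReal (wt x)

lemma ww_meas : Measurable ww := (wt_cont.measurable).ennreal_ofReal

lemma ww_le_one (x : ℝ × ℝ) : ww x ≤ 1 := by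
  unfold ww; rw [← ENNReal.ofReal_one]; exact ENNReal.ofReal_le_ofReal (wt_le_one x)

lemma ww_rpow_le (x : ℝ × ℝ) {p q : ℝ} (h : p ≤ q) : ww x ^ q ≤ ww x ^ p :=
  ENNReal.rpow_le_rpow_of_exponent_ge (ww_le_one x) h

lemma lintegral_ww_ne_top : ∫⁻ x, ww x ≠ ⊤ := by
  unfold ww
  rw [← ofReal_integral_eq_lintegral_ofReal wt_integrable
    (Filter.Eventually.of_forall fun x => (wt_pos x).le)]
  exact ENNReal.ofReal_ne_top

lemma ww_shift (x y : ℝ × ℝ) : ww x * ww y ≤ 4 * ww (x - y) := by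
  unfold ww
  rw [← ENNReal.ofReal_mul (wt_pos x).le]
  have : (4 : ℝ≥0∞) = ENNReal.ofReal 4 := by norm_num
  rw [this, ← ENNReal.ofReal_mul (by norm_num)]
  exact ENNReal.ofReal_le_ofReal (wt_shift x y)

/-- Weighted local Bernstein inequality. -/
lemma weighted_bernstein (s : ℝ) (hs₁ : 1 < s) (hs₂ : s < 2) (K : ℝ≥0∞) (hK : K ≠ ⊤) :
    ∃ K' : ℝ≥0∞, K' ≠ ⊤ ∧ ∀ h : ℝ × ℝ → ℂ, Continuous h →
      (∀ x, ‖h x‖ₑ ≤ K * ∫⁻ y, ww y ^ (2 : ℝ) * ‖h (x - y)‖ₑ) →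
      (∫⁻ x, ww x ^ (2 : ℝ) * ‖h x‖ₑ ^ (2 : ℝ)) ^ (s / 2) ≤ K' * ∫⁻ x, ww x * ‖h x‖ₑ ^ s := by
  have hs0 : 0 < s := by linarith
  set D := ∫⁻ x, ww x with hD
  have hDt : D ≠ ⊤ := lintegral_ww_ne_top
  have hpq : Real.HolderConjugate s.conjExponent s := (Real.HolderConjugate.conjExponent hs₁).symm
  have hs' : 1 < s.conjExponent := hpq.lt
  set K1 : ℝ≥0∞ := K * D ^ (1 / s.conjExponent) with hK1
  have hK1t : K1 ≠ ⊤ := ENNReal.mul_ne_top hK (ENNReal.rpow_ne_top_of_nonneg (by positivity) hDt)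
  set K2 : ℝ≥0∞ := 4 * K1 ^ s with hK2
  have hK2t : K2 ≠ ⊤ := ENNReal.mul_ne_top (by norm_num) (ENNReal.rpow_ne_top_of_nonneg hs0.le hK1t)
  have he : 0 ≤ 2 / s - 1 := by
    rw [sub_nonneg, le_div_iff₀ hs0]; linarith
  refine ⟨(K2 ^ (2 / s - 1)) ^ (s / 2), ENNReal.rpow_ne_top_of_nonneg (by positivity)
    (ENNReal.rpow_ne_top_of_nonneg he hK2t), ?_⟩
  intro h hc hrep
  have hm : Measurable (fun x => ‖h x‖ₑ) := by fun_prop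
  set I := ∫⁻ x, ww x * ‖h x‖ₑ ^ s with hI
  have h1 : ∀ x, ‖h x‖ₑ ≤ K1 * (∫⁻ y, ww y * ‖h (x - y)‖ₑ ^ s) ^ (1 / s) := by
    intro x
    refine (hrep x).trans ?_
    rw [hK1, mul_assoc]
    gcongr
    have hm' : Measurable (fun y => ‖h (x - y)‖ₑ) :=
      (hc.comp (continuous_const.sub continuous_id)).measurable.enorm
    calc ∫⁻ y, ww y ^ (2 : ℝ) * ‖h (x - y)‖ₑ
        = ∫⁻ y, ((ww) * (fun y => ww y * ‖h (x - y)‖ₑ)) y := by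
          refine lintegral_congr fun y => ?_
          simp only [Pi.mul_apply]
          rw [ENNReal.rpow_two, sq, mul_assoc]
      _ ≤ (∫⁻ y, ww y ^ s.conjExponent) ^ (1 / s.conjExponent) *
          (∫⁻ y, (ww y * ‖h (x - y)‖ₑ) ^ s) ^ (1 / s) :=
          ENNReal.lintegral_mul_le_Lp_mul_Lq _ hpq ww_meas.aemeasurable
            (ww_meas.mul hm').aemeasurable
      _ ≤ _ := by
          gcongr with y y
          · rw [hD]
            refine lintegral_mono fun y => ?_
            simpa using ww_rpow_le y hs'.le
          · rw [ENNReal.mul_rpow_of_nonneg _ _ hs0.le]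
            gcongr
            simpa using ww_rpow_le y hs₁.le
  have h2 : ∀ x, ww x * ‖h x‖ₑ ^ s ≤ K2 * I := by
    intro x
    have hm' : Measurable (fun y => ‖h (x - y)‖ₑ) :=
      (hc.comp (continuous_const.sub continuous_id)).measurable.enorm
    calc ww x * ‖h x‖ₑ ^ s
        ≤ ww x * (K1 * (∫⁻ y, ww y * ‖h (x - y)‖ₑ ^ s) ^ (1 / s)) ^ s := by
          gcongr; exact h1 x
      _ = K1 ^ s * (ww x * ∫⁻ y, ww y * ‖h (x - y)‖ₑ ^ s) := by
          rw [ENNReal.mul_rpow_of_nonneg _ _ hs0.le, ← ENNReal.rpow_mul, one_div,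
            inv_mul_cancel₀ hs0.ne', ENNReal.rpow_one]
          ring
      _ = K1 ^ s * ∫⁻ y, ww x * (ww y * ‖h (x - y)‖ₑ ^ s) := by
          rw [← lintegral_const_mul (f := fun y => ww y * ‖h (x - y)‖ₑ ^ s) _
            (ww_meas.mul (hm'.pow_const s))]
      _ ≤ K1 ^ s * ∫⁻ y, 4 * (ww (x - y) * ‖h (x - y)‖ₑ ^ s) := by
          refine mul_le_mul_right (lintegral_mono fun y => ?_) _
          simp only
          rw [← mul_assoc, ← mul_assoc]
          exact mul_le_mul_left (ww_shift x y) _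
      _ = K1 ^ s * (4 * I) := by
          rw [lintegral_const_mul' _ _ (by norm_num)]
          rw [lintegral_sub_left_eq_self (fun y => ww y * ‖h y‖ₑ ^ s) x]
      _ = _ := by rw [hK2]; ring
  have h3 : ∫⁻ x, ww x ^ (2 : ℝ) * ‖h x‖ₑ ^ (2 : ℝ) ≤ K2 ^ (2 / s - 1) * I ^ (2 / s) := by
    calc ∫⁻ x, ww x ^ (2 : ℝ) * ‖h x‖ₑ ^ (2 : ℝ)
        ≤ ∫⁻ x, (K2 * I) ^ (2 / s - 1) * (ww x * ‖h x‖ₑ ^ s) := by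
          refine lintegral_mono fun x => ?_
          calc ww x ^ (2 : ℝ) * ‖h x‖ₑ ^ (2 : ℝ) ≤ ww x ^ (2 / s) * ‖h x‖ₑ ^ (2 : ℝ) := by
                gcongr ?_ * _
                apply ww_rpow_le
                rw [div_le_iff₀ hs0]; linarith
            _ = (ww x * ‖h x‖ₑ ^ s) ^ ((2 / s - 1) + 1) := by
                rw [sub_add_cancel, ENNReal.mul_rpow_of_nonneg _ _ (by positivity),
                  ← ENNReal.rpow_mul, mul_div_cancel₀ _ hs0.ne']
            _ = (ww x * ‖h x‖ₑ ^ s) ^ (2 / s - 1) * (ww x * ‖h x‖ₑ ^ s) := by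
                rw [ENNReal.rpow_add_of_nonneg _ _ he zero_le_one, ENNReal.rpow_one]
            _ ≤ _ := mul_le_mul_left (ENNReal.rpow_le_rpow (h2 x) he) _
      _ = (K2 * I) ^ (2 / s - 1) * I := by
          rw [lintegral_const_mul (f := fun y => ww y * ‖h y‖ₑ ^ s) _
            (ww_meas.mul (hm.pow_const s))]
      _ = _ := by
          rw [ENNReal.mul_rpow_of_nonneg _ _ he, mul_assoc]
          congr 1
          conv_lhs => rw [← ENNReal.rpow_one I]
          rw [← ENNReal.rpow_mul, one_mul, ← ENNReal.rpow_add_of_nonneg _ _ he zero_le_one,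
            sub_add_cancel]
  calc _ ≤ (K2 ^ (2 / s - 1) * I ^ (2 / s)) ^ (s / 2) := by gcongr
    _ = _ := by
      rw [ENNReal.mul_rpow_of_nonneg _ _ (by positivity), ← ENNReal.rpow_mul I]
      have : 2 / s * (s / 2) = 1 := by field_simp
      rw [this, ENNReal.rpow_one]

/-- Weighted almost orthogonality. -/
lemma weighted_orth {ι : Type*} (S : Finset ι) (h : ι → ℝ × ℝ → ℂ) (hc : ∀ i ∈ S, Continuous (h i))
    (hb : ∀ i ∈ S, ∃ B : ℝ, ∀ x, ‖h i x‖ ≤ B)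
    (V : ℝ × ℝ → ℝ) (hV0 : ∀ x, 0 ≤ V x) (hVc : Continuous V) (hVi : Integrable V volume)
    (R : ι → ι → Prop) [DecidableRel R] (hR : ∀ i j, R i j → R j i) (N : ℕ)
    (hN : ∀ i ∈ S, (S.filter (R i)).card ≤ N)
    (horth : ∀ i ∈ S, ∀ j ∈ S, ¬ R i j →
      ∫ x, (V x : ℂ) * (h i x * (starRingEnd ℂ) (h j x)) = 0) :
    ∫⁻ x, ENNReal.ofReal (V x) * ‖∑ i ∈ S, h i x‖ₑ ^ (2 : ℝ) ≤
      N * ∑ i ∈ S, ∫⁻ x, ENNReal.ofReal (V x) * ‖h i x‖ₑ ^ (2 : ℝ) := by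
  have hintg : ∀ i ∈ S, ∀ j ∈ S, Integrable (fun x => (V x : ℂ) * (h i x * (starRingEnd ℂ) (h j x)))
      volume := by
    intro i hi j hj
    obtain ⟨Bi, hBi⟩ := hb i hi
    obtain ⟨Bj, hBj⟩ := hb j hj
    have hci := hc i hi
    have hcj := hc j hj
    refine (hVi.const_mul (Bi * Bj)).mono' ?_ (Filter.Eventually.of_forall fun x => ?_)
    · apply Continuous.aestronglyMeasurable
      exact (Complex.continuous_ofReal.comp hVc).mul (hci.mul (Complex.continuous_conj.comp hcj))
    · rw [norm_mul, Complex.norm_real, Real.norm_of_nonneg (hV0 x), norm_mul, RCLike.norm_conj,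
        mul_comm]
      exact mul_le_mul_of_nonneg_right (mul_le_mul (hBi x) (hBj x) (norm_nonneg _)
        ((norm_nonneg _).trans (hBi x))) (hV0 x)
  have hsq : ∀ (i) (x), V x * ‖h i x‖ ^ 2 = ‖(V x : ℂ) * (h i x * (starRingEnd ℂ) (h i x))‖ := by
    intro i x
    rw [norm_mul, Complex.norm_real, Real.norm_of_nonneg (hV0 x), norm_mul, RCLike.norm_conj, sq]
  set A : ι → ℝ := fun i => ∫ x, V x * ‖h i x‖ ^ 2 with hA
  have hAi : ∀ i ∈ S, Integrable (fun x => V x * ‖h i x‖ ^ 2) volume := by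
    intro i hi
    simp_rw [hsq]
    exact (hintg i hi i hi).norm
  have hA0 : ∀ i, 0 ≤ A i := fun i => integral_nonneg fun x => mul_nonneg (hV0 x) (by positivity)
  set c : ι → ι → ℂ := fun i j => ∫ x, (V x : ℂ) * (h i x * (starRingEnd ℂ) (h j x)) with hcdef
  have hcb : ∀ i ∈ S, ∀ j ∈ S, ‖c i j‖ ≤ (A i + A j) / 2 := by
    intro i hi j hj
    calc ‖c i j‖ ≤ ∫ x, ‖(V x : ℂ) * (h i x * (starRingEnd ℂ) (h j x))‖ :=
          norm_integral_le_integral_norm _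
      _ ≤ ∫ x, (V x * ‖h i x‖ ^ 2 + V x * ‖h j x‖ ^ 2) / 2 := by
          refine integral_mono (hintg i hi j hj).norm (((hAi i hi).add (hAi j hj)).div_const 2) ?_
          intro x
          simp only
          rw [norm_mul, Complex.norm_real, Real.norm_of_nonneg (hV0 x), norm_mul, RCLike.norm_conj]
          have := mul_nonneg (hV0 x) (sq_nonneg (‖h i x‖ - ‖h j x‖))
          nlinarith
      _ = _ := by
          rw [integral_div, integral_add (hAi i hi) (hAi j hj)]
  have hmain : ∫ x, V x * ‖∑ i ∈ S, h i x‖ ^ 2 ≤ N * ∑ i ∈ S, A i := by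
    have e1 : ((∫ x, V x * ‖∑ i ∈ S, h i x‖ ^ 2 : ℝ) : ℂ) = ∑ i ∈ S, ∑ j ∈ S, c i j := by
      rw [← integral_complex_ofReal]
      simp only [hcdef]
      rw [Finset.sum_congr rfl fun i hi => (integral_finsetSum S fun j hj => hintg i hi j hj).symm]
      rw [← integral_finsetSum S fun i hi => integrable_finsetSum S fun j hj => hintg i hi j hj]
      congr 1; ext x
      rw [Complex.ofReal_mul, Complex.ofReal_pow, ← Complex.mul_conj', map_sum, Finset.sum_mul_sum,
        Finset.mul_sum]
      exact Finset.sum_congr rfl fun i _ => Finset.mul_sum _ _ _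
    have e2 : ∫ x, V x * ‖∑ i ∈ S, h i x‖ ^ 2 ≤ ‖∑ i ∈ S, ∑ j ∈ S, c i j‖ := by
      rw [← e1, Complex.norm_real]; exact le_abs_self _
    refine e2.trans ?_
    calc ‖∑ i ∈ S, ∑ j ∈ S, c i j‖ ≤ ∑ i ∈ S, ∑ j ∈ S, ‖c i j‖ :=
          (norm_sum_le _ _).trans (Finset.sum_le_sum fun i _ => norm_sum_le _ _)
      _ ≤ ∑ i ∈ S, ∑ j ∈ S, if R i j then (A i + A j) / 2 else 0 := by
          refine Finset.sum_le_sum fun i hi => Finset.sum_le_sum fun j hj => ?_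
          split_ifs with hr
          · exact hcb i hi j hj
          · rw [hcdef]; simp only; rw [horth i hi j hj hr, norm_zero]
      _ = ∑ i ∈ S, ∑ j ∈ S, ((if R i j then A i / 2 else 0) + (if R i j then A j / 2 else 0)) := by
          refine Finset.sum_congr rfl fun i hi => Finset.sum_congr rfl fun j hj => ?_
          split_ifs <;> ring
      _ = ∑ i ∈ S, ∑ j ∈ S, (if R i j then A i / 2 else 0) +
          ∑ i ∈ S, ∑ j ∈ S, (if R i j then A j / 2 else 0) := by
          simp_rw [Finset.sum_add_distrib]
      _ = ∑ i ∈ S, ∑ j ∈ S, (if R i j then A i / 2 else 0) +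
          ∑ i ∈ S, ∑ j ∈ S, (if R i j then A i / 2 else 0) := by
          congr 1
          rw [Finset.sum_comm]
          refine Finset.sum_congr rfl fun i hi => Finset.sum_congr rfl fun j hj => ?_
          have : R j i ↔ R i j := ⟨hR _ _, hR _ _⟩
          simp [this]
      _ ≤ ∑ i ∈ S, N * (A i / 2) + ∑ i ∈ S, N * (A i / 2) := by
          have : ∀ i ∈ S, ∑ j ∈ S, (if R i j then A i / 2 else 0) ≤ N * (A i / 2) := by
            intro i hi
            rw [← Finset.sum_filter, Finset.sum_const, nsmul_eq_mul]
            have := hN i hi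
            have h0 := hA0 i
            gcongr
          exact add_le_add (Finset.sum_le_sum this) (Finset.sum_le_sum this)
      _ = _ := by
          rw [← Finset.sum_add_distrib, Finset.mul_sum]
          exact Finset.sum_congr rfl fun i _ => by ring
  have conv : ∀ g : ℝ × ℝ → ℂ, Integrable (fun x => V x * ‖g x‖ ^ 2) volume →
      ∫⁻ x, ENNReal.ofReal (V x) * ‖g x‖ₑ ^ (2 : ℝ) = ENNReal.ofReal (∫ x, V x * ‖g x‖ ^ 2) := by
    intro g hg
    rw [ofReal_integral_eq_lintegral_ofReal hg
      (Filter.Eventually.of_forall fun x => mul_nonneg (hV0 x) (by positivity))]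
    refine lintegral_congr fun x => ?_
    rw [ENNReal.ofReal_mul (hV0 x), ENNReal.ofReal_pow (norm_nonneg _), ofReal_norm,
      ENNReal.rpow_two]
  have hHi : Integrable (fun x => V x * ‖∑ i ∈ S, h i x‖ ^ 2) volume := by
    have := integrable_finsetSum S fun i hi => integrable_finsetSum S fun j hj => hintg i hi j hj
    refine this.norm.congr (Filter.Eventually.of_forall fun x => ?_)
    simp only
    simp_rw [← Finset.mul_sum, ← Finset.sum_mul, ← map_sum]
    rw [norm_mul, Complex.norm_real, Real.norm_of_nonneg (hV0 x), norm_mul, RCLike.norm_conj, sq]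
  rw [conv _ hHi, Finset.sum_congr rfl fun i hi => conv _ (hAi i hi)]
  rw [← ENNReal.ofReal_sum_of_nonneg fun i _ => hA0 i]
  rw [← ENNReal.ofReal_natCast, ← ENNReal.ofReal_mul (by positivity)]
  exact ENNReal.ofReal_le_ofReal hmain

open MeasureTheory Set
open scoped ENNReal

lemma rpow_sum_le_sum_rpow_aux {ι : Type*} (S : Finset ι) (f : ι → ℝ≥0∞) {p : ℝ} (hp : 0 < p)
    (hp1 : p ≤ 1) : (∑ i ∈ S, f i) ^ p ≤ ∑ i ∈ S, f i ^ p := by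
  classical
  induction S using Finset.induction_on with
  | empty => simp [hp]
  | insert a S ha ih =>
    rw [Finset.sum_insert ha, Finset.sum_insert ha]
    exact (ENNReal.rpow_add_le_add_rpow _ _ hp.le hp1).trans (add_le_add_right ih _)

lemma osc_almost_orth (s : ℝ) (hs₁ : 1 < s) (hs₂ : s < 2) (N : ℕ) :
    ∃ K : ℝ≥0∞, K ≠ ⊤ ∧ ∀ (Z : Type) [MeasurableSpace Z] (μ : Measure Z) [SFinite μ]
      (α β : Z → ℝ) (_ : Measurable α) (_ : Measurable β) (ι : Type) (S : Finset ι)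
      (a : ι → Z → ℂ) (p q : ι → ℝ) (_ : ∀ i ∈ S, Integrable (a i) μ)
      (_ : ∀ i ∈ S, ∀ z, a i z ≠ 0 → |α z - p i| ≤ 1 ∧ |β z - q i| ≤ 1)
      (_ : ∀ i ∈ S, (S.filter fun j => |p i - p j| < 3 ∧ |q i - q j| < 3).card ≤ N),
      ∫⁻ x, ‖∑ i ∈ S, osc μ α β (a i) x‖ₑ ^ s ≤ K * ∑ i ∈ S, ∫⁻ x, ‖osc μ α β (a i) x‖ₑ ^ s := by
  have hs0 : 0 < s := by linarith
  obtain ⟨W, c, ρ, CW, hWc, hc, hρ, hCW, hW0, hWlow, hWdec, hWvan⟩ := exists_weight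
  obtain ⟨ψ, Cψ, hψc, hCψ, hψdec, hψ1⟩ := exists_repr
  obtain ⟨KB, hKB, hbern⟩ := weighted_bernstein s hs₁ hs₂ (ENNReal.ofReal (Cψ ^ 2)) ENNReal.ofReal_ne_top
  set V : ℝ × ℝ → ℝ := fun x => W x.1 * W x.2 with hV
  have hV0 : ∀ x, 0 ≤ V x := fun x => mul_nonneg (hW0 _) (hW0 _)
  have hVc : Continuous V := by fun_prop
  have hVdec : ∀ x, V x ≤ CW ^ 2 * wt x ^ 2 := by
    intro y
    calc W y.1 * W y.2 ≤ (CW * ((1 + y.1 ^ 2)⁻¹) ^ 2) * (CW * ((1 + y.2 ^ 2)⁻¹) ^ 2) :=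
          mul_le_mul (hWdec _) (hWdec _) (hW0 _) ((hW0 _).trans (hWdec _))
      _ = _ := by unfold wt; ring
  have hVi : Integrable V volume :=
    (wt_sq_integrable.const_mul (CW ^ 2)).mono' hVc.aestronglyMeasurable
      (Filter.Eventually.of_forall fun x => by rw [Real.norm_of_nonneg (hV0 x)]; exact hVdec x)
  have hVdec' : ∀ x, ENNReal.ofReal (V x) ≤ ENNReal.ofReal (CW ^ 2) * ww x ^ (2 : ℝ) := by
    intro x
    rw [ENNReal.rpow_two, ww, ← ENNReal.ofReal_pow (wt_pos x).le, ← ENNReal.ofReal_mul (by positivity)]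
    exact ENNReal.ofReal_le_ofReal (hVdec x)
  set Q : Set (ℝ × ℝ) := Icc (-ρ) ρ ×ˢ Icc (-ρ) ρ with hQ
  have hQm : MeasurableSet Q := measurableSet_Icc.prod measurableSet_Icc
  have hVlow : ∀ x ∈ Q, c ^ 2 ≤ V x := by
    rintro x ⟨h1, h2⟩
    have e1 := hWlow x.1 (abs_le.2 h1)
    have e2 := hWlow x.2 (abs_le.2 h2)
    rw [sq]; exact mul_le_mul e1 e2 hc.le (hW0 _)
  set m := (volume Q) with hm
  have hmval : m = ENNReal.ofReal (ρ - -ρ) * ENNReal.ofReal (ρ - -ρ) := by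
    rw [hm, hQ, Measure.volume_eq_prod, Measure.prod_prod, Real.volume_Icc]
  have hm0 : m ≠ 0 := by
    rw [hmval]; simp; linarith
  have hmt : m ≠ ⊤ := by rw [hmval]; exact ENNReal.mul_ne_top ENNReal.ofReal_ne_top ENNReal.ofReal_ne_top
  set e : ℝ≥0∞ := ENNReal.ofReal (c ^ 2) with he
  have he0 : e ≠ 0 := by rw [he]; simp; positivity
  have het : e ≠ ⊤ := ENNReal.ofReal_ne_top
  set D := ∫⁻ x, ww x with hD
  have hDt : D ≠ ⊤ := lintegral_ww_ne_top
  -- bound constants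
  set K1 : ℝ≥0∞ := m ^ (1 - s / 2) * (e⁻¹ * (N * ENNReal.ofReal (CW ^ 2))) ^ (s / 2) * KB with hK1
  have hK1t : K1 ≠ ⊤ := by
    refine ENNReal.mul_ne_top (ENNReal.mul_ne_top ?_ ?_) hKB
    · exact ENNReal.rpow_ne_top_of_nonneg (by linarith) hmt
    · refine ENNReal.rpow_ne_top_of_nonneg (by positivity) (ENNReal.mul_ne_top ?_ ?_)
      · exact ENNReal.inv_ne_top.2 he0
      · exact ENNReal.mul_ne_top (by simp) ENNReal.ofReal_ne_top
  refine ⟨m⁻¹ * (K1 * D), ENNReal.mul_ne_top (ENNReal.inv_ne_top.2 hm0)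
    (ENNReal.mul_ne_top hK1t hDt), ?_⟩
  intro Z _ μ _ α β hα hβ ι S a p q ha hsupp hcard
  set h : ι → ℝ × ℝ → ℂ := fun i => osc μ α β (a i) with hh
  have hhc : ∀ i ∈ S, Continuous (h i) := fun i hi => osc_cont hα hβ (ha i hi)
  set H : ℝ × ℝ → ℂ := fun x => ∑ i ∈ S, h i x with hH
  have hHc : Continuous H := by
    rw [hH]; exact continuous_finsetSum _ hhc
  -- pointwise in the base point
  have hpt : ∀ x0, ∫⁻ y in Q, ‖H (x0 + y)‖ₑ ^ s ≤
      K1 * ∑ i ∈ S, ∫⁻ y, ww y * ‖h i (x0 + y)‖ₑ ^ s := by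
    intro x0
    have hHm : Measurable fun y => ‖H (x0 + y)‖ₑ := (hHc.comp (continuous_const.add continuous_id)).measurable.enorm
    set a' : ι → Z → ℂ := fun i z =>
      a i z * Complex.exp (Complex.I * (x0.1 * α z + x0.2 * β z : ℝ)) with ha'
    have hsh : ∀ i y, h i (x0 + y) = osc μ α β (a' i) y := fun i y => osc_shift _ _ _
    have ha'i : ∀ i ∈ S, Integrable (a' i) μ := fun i hi => osc_shift_integrable hα hβ (ha i hi) x0
    have ha's : ∀ i ∈ S, ∀ z, a' i z ≠ 0 → |α z - p i| ≤ 1 ∧ |β z - q i| ≤ 1 := by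
      intro i hi z hz
      exact hsupp i hi z (left_ne_zero_of_mul hz)
    have s1 : ∫⁻ y in Q, ‖H (x0 + y)‖ₑ ^ s ≤
        m ^ (1 - s / 2) * (∫⁻ y in Q, ‖H (x0 + y)‖ₑ ^ (2 : ℝ)) ^ (s / 2) := by
      have hpq : Real.HolderConjugate (2 / s) (2 / s).conjExponent :=
        Real.HolderConjugate.conjExponent (by rw [lt_div_iff₀ hs0]; linarith)
      have := ENNReal.lintegral_mul_le_Lp_mul_Lq (volume.restrict Q) hpq
        (f := fun y => ‖H (x0 + y)‖ₑ ^ s) (g := fun _ => 1) (hHm.pow_const s).aemeasurable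
        aemeasurable_const
      simp only [Pi.mul_apply, mul_one, ENNReal.one_rpow, lintegral_const, one_mul,
        Measure.restrict_apply MeasurableSet.univ, univ_inter, ← ENNReal.rpow_mul] at this
      refine this.trans (le_of_eq ?_)
      rw [mul_comm]
      have e1 : 1 / (2 / s).conjExponent = 1 - s / 2 := by
        have := hpq.inv_add_inv_eq_one
        rw [inv_div] at this
        rw [one_div]; linarith
      have e2 : s * (2 / s) = 2 := by field_simp
      have e3 : 1 / (2 / s) = s / 2 := by rw [one_div_div]
      rw [e1, e2, e3]
    have s2 : ∫⁻ y in Q, ‖H (x0 + y)‖ₑ ^ (2 : ℝ) ≤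
        e⁻¹ * ∫⁻ y, ENNReal.ofReal (V y) * ‖H (x0 + y)‖ₑ ^ (2 : ℝ) := by
      calc ∫⁻ y in Q, ‖H (x0 + y)‖ₑ ^ (2 : ℝ)
          ≤ ∫⁻ y in Q, e⁻¹ * (ENNReal.ofReal (V y) * ‖H (x0 + y)‖ₑ ^ (2 : ℝ)) := by
            refine setLIntegral_mono' hQm fun y hy => ?_
            rw [← mul_assoc]
            conv_lhs => rw [← one_mul (‖H (x0 + y)‖ₑ ^ (2 : ℝ)), ← ENNReal.inv_mul_cancel he0 het]
            refine mul_le_mul_left (mul_le_mul_right ?_ _) _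
            exact ENNReal.ofReal_le_ofReal (hVlow y hy)
        _ ≤ ∫⁻ y, e⁻¹ * (ENNReal.ofReal (V y) * ‖H (x0 + y)‖ₑ ^ (2 : ℝ)) :=
            setLIntegral_le_lintegral _ _
        _ = _ := lintegral_const_mul' _ _ (ENNReal.inv_ne_top.2 he0)
    have s3 : ∫⁻ y, ENNReal.ofReal (V y) * ‖H (x0 + y)‖ₑ ^ (2 : ℝ) ≤
        N * ∑ i ∈ S, ∫⁻ y, ENNReal.ofReal (V y) * ‖osc μ α β (a' i) y‖ₑ ^ (2 : ℝ) := by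
      classical
      have := weighted_orth S (fun i => osc μ α β (a' i)) (fun i hi => osc_cont hα hβ (ha'i i hi))
        (fun i hi => ⟨_, osc_norm_le (a' i)⟩) V hV0 hVc hVi
        (fun i j => |p i - p j| < 3 ∧ |q i - q j| < 3)
        (fun i j hij => ⟨by rw [abs_sub_comm]; exact hij.1, by rw [abs_sub_comm]; exact hij.2⟩) N
        (fun i hi => by convert hcard i hi) ?_
      · simp only [hH, hsh]; exact this
      · intro i hi j hj hij
        refine osc_orth hα hβ (ha'i i hi) (ha'i j hj) hWc hW0 hWdec hWvan ?_
        rw [not_and_or, not_lt, not_lt] at hij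
        rcases hij with hij | hij
        · left
          intro z z' hz hz'
          have h1 := (ha's i hi z hz).1
          have h2 := (ha's j hj z' hz').1
          have := abs_sub_le (p i) (α z) (p j)
          have := abs_sub_le (α z) (α z') (p j)
          rw [abs_sub_comm] at h1
          linarith
        · right
          intro z z' hz hz'
          have h1 := (ha's i hi z hz).2
          have h2 := (ha's j hj z' hz').2
          have := abs_sub_le (q i) (β z) (q j)
          have := abs_sub_le (β z) (β z') (q j)
          rw [abs_sub_comm] at h1
          linarith
    have s4 : ∀ i ∈ S, (∫⁻ y, ww y ^ (2 : ℝ) * ‖osc μ α β (a' i) y‖ₑ ^ (2 : ℝ)) ^ (s / 2) ≤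
        KB * ∫⁻ y, ww y * ‖osc μ α β (a' i) y‖ₑ ^ s := by
      intro i hi
      refine hbern _ (osc_cont hα hβ (ha'i i hi)) fun x => ?_
      have := osc_reproduce hα hβ (ha'i i hi) hψc hψdec hψ1 (p i) (q i) (ha's i hi) x
      refine this.trans (le_of_eq ?_)
      congr 1
      refine lintegral_congr fun y => ?_
      rw [ENNReal.rpow_two, ww, ENNReal.ofReal_pow (wt_pos y).le]
    calc ∫⁻ y in Q, ‖H (x0 + y)‖ₑ ^ s
        ≤ m ^ (1 - s / 2) * (∫⁻ y in Q, ‖H (x0 + y)‖ₑ ^ (2 : ℝ)) ^ (s / 2) := s1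
      _ ≤ m ^ (1 - s / 2) * (e⁻¹ * (N * ∑ i ∈ S, ∫⁻ y, (ENNReal.ofReal (CW ^ 2) * ww y ^ (2 : ℝ)) *
          ‖osc μ α β (a' i) y‖ₑ ^ (2 : ℝ))) ^ (s / 2) := by
          refine mul_le_mul_right (ENNReal.rpow_le_rpow (s2.trans (mul_le_mul_right (s3.trans
            (mul_le_mul_right (Finset.sum_le_sum fun i hi => lintegral_mono fun y => ?_) _)) _))
            (by positivity)) _
          exact mul_le_mul_left (hVdec' y) _
      _ = m ^ (1 - s / 2) * ((e⁻¹ * (N * ENNReal.ofReal (CW ^ 2))) *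
          ∑ i ∈ S, ∫⁻ y, ww y ^ (2 : ℝ) * ‖osc μ α β (a' i) y‖ₑ ^ (2 : ℝ)) ^ (s / 2) := by
          have : ∀ i, ∫⁻ y, (ENNReal.ofReal (CW ^ 2) * ww y ^ (2 : ℝ)) *
              ‖osc μ α β (a' i) y‖ₑ ^ (2 : ℝ) = ENNReal.ofReal (CW ^ 2) *
              ∫⁻ y, ww y ^ (2 : ℝ) * ‖osc μ α β (a' i) y‖ₑ ^ (2 : ℝ) := by
            intro i
            rw [← lintegral_const_mul' _ _ ENNReal.ofReal_ne_top]
            exact lintegral_congr fun y => mul_assoc _ _ _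
          simp_rw [this]
          rw [← Finset.mul_sum, mul_assoc, mul_assoc]
      _ ≤ m ^ (1 - s / 2) * ((e⁻¹ * (N * ENNReal.ofReal (CW ^ 2))) ^ (s / 2) *
          ∑ i ∈ S, (∫⁻ y, ww y ^ (2 : ℝ) * ‖osc μ α β (a' i) y‖ₑ ^ (2 : ℝ)) ^ (s / 2)) := by
          rw [ENNReal.mul_rpow_of_nonneg _ _ (by positivity : 0 ≤ s / 2)]
          refine mul_le_mul_right (mul_le_mul_right ?_ _) _
          exact rpow_sum_le_sum_rpow_aux _ _ (by positivity) (by linarith)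
      _ ≤ m ^ (1 - s / 2) * ((e⁻¹ * (N * ENNReal.ofReal (CW ^ 2))) ^ (s / 2) *
          ∑ i ∈ S, KB * ∫⁻ y, ww y * ‖osc μ α β (a' i) y‖ₑ ^ s) :=
          mul_le_mul_right (mul_le_mul_right (Finset.sum_le_sum s4) _) _
      _ = _ := by
          simp_rw [hsh]
          rw [← Finset.mul_sum, hK1]; ring
  have hkey : m * ∫⁻ x, ‖H x‖ₑ ^ s ≤ (K1 * D) * ∑ i ∈ S, ∫⁻ x, ‖h i x‖ₑ ^ s := by
    have hmeas2 : ∀ g : ℝ × ℝ → ℂ, Continuous g →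
        Measurable (fun z : (ℝ × ℝ) × (ℝ × ℝ) => ‖g (z.1 + z.2)‖ₑ ^ s) := fun g hg =>
      (hg.comp (continuous_fst.add continuous_snd)).measurable.enorm.pow_const s
    calc m * ∫⁻ x, ‖H x‖ₑ ^ s = ∫⁻ y in Q, ∫⁻ x, ‖H (x + y)‖ₑ ^ s := by
          simp_rw [lintegral_add_right_eq_self (fun x => ‖H x‖ₑ ^ s)]
          rw [lintegral_const, Measure.restrict_apply MeasurableSet.univ, univ_inter, mul_comm]
      _ = ∫⁻ x, ∫⁻ y in Q, ‖H (x + y)‖ₑ ^ s :=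
          (lintegral_lintegral_swap (hmeas2 H hHc).aemeasurable).symm
      _ ≤ ∫⁻ x, K1 * ∑ i ∈ S, ∫⁻ y, ww y * ‖h i (x + y)‖ₑ ^ s := lintegral_mono hpt
      _ = K1 * ∑ i ∈ S, ∫⁻ x, ∫⁻ y, ww y * ‖h i (x + y)‖ₑ ^ s := by
          rw [lintegral_const_mul' _ _ hK1t, lintegral_finsetSum']
          intro i hi
          apply Measurable.aemeasurable
          exact Measurable.lintegral_prod_right'
            (f := fun z : (ℝ × ℝ) × (ℝ × ℝ) => ww z.2 * ‖h i (z.1 + z.2)‖ₑ ^ s)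
            ((ww_meas.comp measurable_snd).mul (hmeas2 _ (hhc i hi)))
      _ = K1 * ∑ i ∈ S, D * ∫⁻ x, ‖h i x‖ₑ ^ s := by
          congr 1
          refine Finset.sum_congr rfl fun i hi => ?_
          rw [lintegral_lintegral_swap
            ((ww_meas.comp measurable_snd).mul (hmeas2 _ (hhc i hi))).aemeasurable]
          have : ∀ y, ∫⁻ x, ww y * ‖h i (x + y)‖ₑ ^ s = ww y * ∫⁻ x, ‖h i x‖ₑ ^ s := by
            intro y
            rw [lintegral_const_mul' _ _ ((ww_le_one y).trans_lt ENNReal.one_lt_top).ne]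
            rw [lintegral_add_right_eq_self (fun x => ‖h i x‖ₑ ^ s)]
          simp_rw [this]
          rw [lintegral_mul_const _ ww_meas]
      _ = _ := by rw [← Finset.mul_sum]; ring
  calc ∫⁻ x, ‖H x‖ₑ ^ s = m⁻¹ * (m * ∫⁻ x, ‖H x‖ₑ ^ s) := by
        rw [← mul_assoc, ENNReal.inv_mul_cancel hm0 hmt, one_mul]
    _ ≤ m⁻¹ * ((K1 * D) * ∑ i ∈ S, ∫⁻ x, ‖h i x‖ₑ ^ s) := mul_le_mul_right hkey _
    _ = _ := by rw [← mul_assoc]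

open MeasureTheory Set
open scoped ENNReal

lemma extOp_cont {f : ℝ × ℝ → ℂ} (hf : Integrable f volume) : Continuous (extOp f) := by
  unfold extOp
  refine continuous_of_dominated (bound := fun z => ‖f z‖) ?_ ?_ hf.norm ?_
  · intro x
    refine AEStronglyMeasurable.mul ?_ hf.aestronglyMeasurable
    apply Continuous.aestronglyMeasurable
    fun_prop
  · intro x
    refine Filter.Eventually.of_forall fun z => ?_
    rw [norm_mul, norm_expI, one_mul]
  · refine Filter.Eventually.of_forall fun z => ?_
    fun_prop

lemma extOp_mul_osc (f g : ℝ × ℝ → ℂ) (t : ℝ) (x : ℝ × ℝ) :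
    extOp f (t, x) * extOp g (t, x) =
      osc (volume : Measure ((ℝ × ℝ) × (ℝ × ℝ))) (fun z => z.1.1 + z.2.1) (fun z => z.1.2 + z.2.2)
        (fun z => (Complex.exp (Complex.I * (t * z.1.1 * z.1.2 : ℝ)) * f z.1) *
          (Complex.exp (Complex.I * (t * z.2.1 * z.2.2 : ℝ)) * g z.2)) x := by
  unfold extOp osc
  rw [← integral_prod_mul]
  rw [← Measure.volume_eq_prod]
  congr 1; ext z
  have : Complex.exp (Complex.I * (t * z.1.1 * z.1.2 + x.1 * z.1.1 + x.2 * z.1.2 : ℝ)) *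
    Complex.exp (Complex.I * (t * z.2.1 * z.2.2 + x.1 * z.2.1 + x.2 * z.2.2 : ℝ)) =
    Complex.exp (Complex.I * (t * z.1.1 * z.1.2 : ℝ)) * Complex.exp (Complex.I * (t * z.2.1 * z.2.2 : ℝ))
    * Complex.exp (Complex.I * (x.1 * (z.1.1 + z.2.1) + x.2 * (z.1.2 + z.2.2) : ℝ)) := by
    rw [← Complex.exp_add, ← Complex.exp_add, ← Complex.exp_add]
    congr 1; push_cast; ring
  linear_combination (f z.1 * g z.2) * this

lemma phase_integrable {f : ℝ × ℝ → ℂ} (hf : Integrable f volume) (t : ℝ) :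
    Integrable (fun ξ : ℝ × ℝ => Complex.exp (Complex.I * (t * ξ.1 * ξ.2 : ℝ)) * f ξ) volume := by
  refine hf.norm.mono' ?_ ?_
  · refine AEStronglyMeasurable.mul ?_ hf.aestronglyMeasurable
    apply Continuous.aestronglyMeasurable
    fun_prop
  · refine Filter.Eventually.of_forall fun z => ?_
    rw [norm_mul, norm_expI, one_mul]

/-- Half-open unit cells. -/
def cell (m₁ m₂ : ℤ) : Set (ℝ × ℝ) := {ξ | ⌊ξ.1⌋ = m₁ ∧ ⌊ξ.2⌋ = m₂}

lemma cell_meas (m₁ m₂ : ℤ) : MeasurableSet (cell m₁ m₂) := by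
  have h1 : Measurable fun ξ : ℝ × ℝ => ⌊ξ.1⌋ := Int.measurable_floor.comp measurable_fst
  have h2 : Measurable fun ξ : ℝ × ℝ => ⌊ξ.2⌋ := Int.measurable_floor.comp measurable_snd
  exact (h1 (measurableSet_singleton m₁)).inter (h2 (measurableSet_singleton m₂))

lemma cell_sub (m₁ m₂ : ℤ) : cell m₁ m₂ ⊆ unitSq m₁ m₂ := by
  rintro ξ ⟨h1, h2⟩
  have a := Int.floor_eq_iff.1 h1
  have b := Int.floor_eq_iff.1 h2
  exact ⟨⟨a.1, a.2.le⟩, ⟨b.1, b.2.le⟩⟩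

lemma unitSq_vol (a b : ℝ) : volume (unitSq a b) = 1 := by
  unfold unitSq
  rw [Measure.volume_eq_prod, Measure.prod_prod]; simp

lemma chi_integrable {S : Set (ℝ × ℝ)} (hS : MeasurableSet S) (hv : volume S ≠ ⊤) :
    Integrable (chi S) volume := by
  unfold chi
  rw [integrable_indicator_iff hS]
  exact integrableOn_const hv

lemma cell_fin (B : Set (ℝ × ℝ)) (m₁ m₂ : ℤ) : volume (B ∩ cell m₁ m₂) ≠ ⊤ :=
  ((measure_mono (inter_subset_right.trans (cell_sub _ _))).trans_lt
    (by rw [unitSq_vol]; exact ENNReal.one_lt_top)).ne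

lemma chi_cell_integrable {B : Set (ℝ × ℝ)} (hB : MeasurableSet B) (m₁ m₂ : ℤ) :
    Integrable (chi (B ∩ cell m₁ m₂)) volume :=
  chi_integrable (hB.inter (cell_meas _ _)) (cell_fin _ _ _)

lemma chi_ne {S : Set (ℝ × ℝ)} {ξ : ℝ × ℝ} (h : chi S ξ ≠ 0) : ξ ∈ S := by
  by_contra hh
  exact h (indicator_of_notMem hh _)

/-- The bilinear pieces. -/
noncomputable def piece (B : Set (ℝ × ℝ)) (i : (ℤ × ℤ) × (ℤ × ℤ)) (p : ℝ × ℝ × ℝ) : ℂ :=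
  extOp (chi (B ∩ cell i.1.1 i.2.1)) p * extOp (chi (B ∩ cell i.1.2 i.2.2)) p

lemma piece_cont {B : Set (ℝ × ℝ)} (hB : MeasurableSet B) (i : (ℤ × ℤ) × (ℤ × ℤ)) :
    Continuous (piece B i) :=
  (extOp_cont (chi_cell_integrable hB _ _)).mul (extOp_cont (chi_cell_integrable hB _ _))

lemma nbr_card (S : Finset ((ℤ × ℤ) × (ℤ × ℤ)))
    (hS : ∀ i ∈ S, |i.1.1 - i.1.2| ≤ 3 ∧ |i.2.1 - i.2.2| ≤ 3) (i) (hi : i ∈ S) :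
    (S.filter fun j => |((i.1.1 + i.1.2 + 1 : ℤ) : ℝ) - ((j.1.1 + j.1.2 + 1 : ℤ) : ℝ)| < 3 ∧
      |((i.2.1 + i.2.2 + 1 : ℤ) : ℝ) - ((j.2.1 + j.2.2 + 1 : ℤ) : ℝ)| < 3).card ≤ 50625 := by
  set R : Finset ((ℤ × ℤ) × (ℤ × ℤ)) :=
    (Finset.Icc (i.1.1 - 7) (i.1.1 + 7) ×ˢ Finset.Icc (i.1.1 - 7) (i.1.1 + 7)) ×ˢ
    (Finset.Icc (i.2.1 - 7) (i.2.1 + 7) ×ˢ Finset.Icc (i.2.1 - 7) (i.2.1 + 7)) with hR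
  have hRc : R.card = 50625 := by
    rw [hR]
    have : ∀ a : ℤ, (a + 7 + 1 - (a - 7)).toNat = 15 := by intro a; ring_nf; rfl
    simp only [Finset.card_product, Int.card_Icc, this]
  rw [← hRc]
  apply Finset.card_le_card
  intro j hj
  rw [Finset.mem_filter] at hj
  obtain ⟨hjS, h1, h2⟩ := hj
  have a := hS i hi
  have b := hS j hjS
  have h1' : |(i.1.1 + i.1.2 + 1) - (j.1.1 + j.1.2 + 1)| < 3 := by exact_mod_cast h1
  have h2' : |(i.2.1 + i.2.2 + 1) - (j.2.1 + j.2.2 + 1)| < 3 := by exact_mod_cast h2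
  simp only [abs_le, abs_lt] at a b h1' h2'
  simp only [hR, Finset.mem_product, Finset.mem_Icc]
  omega

lemma unit_orth (s : ℝ) (hs₁ : 1 < s) (hs₂ : s < 2) : ∃ K : ℝ≥0∞, K ≠ ⊤ ∧
    ∀ (B : Set (ℝ × ℝ)) (_ : MeasurableSet B) (S : Finset ((ℤ × ℤ) × (ℤ × ℤ)))
      (_ : ∀ i ∈ S, |i.1.1 - i.1.2| ≤ 3 ∧ |i.2.1 - i.2.2| ≤ 3),
      ∫⁻ p, ‖∑ i ∈ S, piece B i p‖ₑ ^ s ≤ K * ∑ i ∈ S, ∫⁻ p, ‖piece B i p‖ₑ ^ s := by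
  obtain ⟨K, hK, hmain⟩ := osc_almost_orth s hs₁ hs₂ 50625
  refine ⟨K, hK, fun B hB S hS => ?_⟩
  have hm : Continuous fun p => ∑ i ∈ S, piece B i p :=
    continuous_finsetSum _ fun i _ => piece_cont hB i
  rw [Measure.volume_eq_prod, lintegral_prod _ (hm.measurable.enorm.pow_const s).aemeasurable]
  have : ∀ i ∈ S, ∫⁻ p, ‖piece B i p‖ₑ ^ s ∂((volume : Measure ℝ).prod (volume : Measure (ℝ × ℝ)))
      = ∫⁻ t, ∫⁻ x, ‖piece B i (t, x)‖ₑ ^ s := fun i _ =>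
    lintegral_prod _ ((piece_cont hB i).measurable.enorm.pow_const s).aemeasurable
  rw [Finset.sum_congr rfl this, ← lintegral_finsetSum', ← lintegral_const_mul' _ _ hK]
  swap
  · intro i _
    exact (Measurable.lintegral_prod_right'
      ((piece_cont hB i).measurable.enorm.pow_const s)).aemeasurable
  refine lintegral_mono fun t => ?_
  have key := hmain ((ℝ × ℝ) × (ℝ × ℝ)) volume (fun z => z.1.1 + z.2.1) (fun z => z.1.2 + z.2.2)
    (by fun_prop) (by fun_prop) ((ℤ × ℤ) × (ℤ × ℤ)) S
    (fun i z => (Complex.exp (Complex.I * (t * z.1.1 * z.1.2 : ℝ)) * chi (B ∩ cell i.1.1 i.2.1) z.1) *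
          (Complex.exp (Complex.I * (t * z.2.1 * z.2.2 : ℝ)) * chi (B ∩ cell i.1.2 i.2.2) z.2))
    (fun i => ((i.1.1 + i.1.2 + 1 : ℤ) : ℝ)) (fun i => ((i.2.1 + i.2.2 + 1 : ℤ) : ℝ))
    ?_ ?_ (nbr_card S hS)
  · simp only [← extOp_mul_osc] at key
    exact key
  · intro i _
    exact (phase_integrable (chi_cell_integrable hB _ _) t).mul_prod
      (phase_integrable (chi_cell_integrable hB _ _) t)
  · intro i _ z hz
    have z1 := (chi_ne (right_ne_zero_of_mul (left_ne_zero_of_mul hz))).2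
    have z2 := (chi_ne (right_ne_zero_of_mul (right_ne_zero_of_mul hz))).2
    have a1 := Int.floor_eq_iff.1 z1.1
    have a2 := Int.floor_eq_iff.1 z1.2
    have b1 := Int.floor_eq_iff.1 z2.1
    have b2 := Int.floor_eq_iff.1 z2.2
    simp only [abs_le]; push_cast
    refine ⟨⟨?_, ?_⟩, ⟨?_, ?_⟩⟩ <;> linarith

lemma eLpNorm_chi {S : Set (ℝ × ℝ)} (hS : MeasurableSet S) {r : ℝ} (hr : 0 < r) :
    eLpNorm (chi S) (ENNReal.ofReal r) volume = volume S ^ (1 / r) := by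
  unfold chi
  rw [eLpNorm_indicator_const hS (by simpa using hr) ENNReal.ofReal_ne_top]
  simp [ENNReal.toReal_ofReal hr.le]

lemma eLpNorm_rpow_eq {X : Type*} [MeasurableSpace X] {μ : Measure X} (f : X → ℂ) {s : ℝ} (hs : 0 < s) :
    eLpNorm f (ENNReal.ofReal s) μ ^ s = ∫⁻ x, ‖f x‖ₑ ^ s ∂μ := by
  rw [eLpNorm_eq_lintegral_rpow_enorm_toReal (by simpa using hs) ENNReal.ofReal_ne_top, ENNReal.toReal_ofReal hs.le, ← ENNReal.rpow_mul]
  rw [one_div, inv_mul_cancel₀ hs.ne', ENNReal.rpow_one]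

lemma piece_bound {s r A : ℝ} (hs : 0 < s) (hr : 0 < r) (hBH : BH s r A) {B : Set (ℝ × ℝ)}
    (hB : MeasurableSet B) (i : (ℤ × ℤ) × (ℤ × ℤ))
    (hi : 2 ≤ |i.1.1 - i.1.2| ∧ |i.1.1 - i.1.2| ≤ 3 ∧ 2 ≤ |i.2.1 - i.2.2| ∧ |i.2.1 - i.2.2| ≤ 3) :
    ∫⁻ p, ‖piece B i p‖ₑ ^ s ≤ ENNReal.ofReal A ^ s *
      (volume (B ∩ cell i.1.1 i.2.1) ^ (s / r) * volume (B ∩ cell i.1.2 i.2.2) ^ (s / r)) := by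
  obtain ⟨h1, h2, h3, h4⟩ := hi
  have := hBH i.1.1 i.2.1 i.1.2 i.2.2 (by exact_mod_cast h1)
    (by have : |i.1.1 - i.1.2| ≤ 5 := by omega
        exact_mod_cast this) (by exact_mod_cast h3)
    (by have : |i.2.1 - i.2.2| ≤ 5 := by omega
        exact_mod_cast this) (chi (B ∩ cell i.1.1 i.2.1)) (chi (B ∩ cell i.1.2 i.2.2))
    (fun ξ hξ => cell_sub _ _ (chi_ne hξ).2) (fun ξ hξ => cell_sub _ _ (chi_ne hξ).2)
  rw [eLpNorm_chi (hB.inter (cell_meas _ _)) hr, eLpNorm_chi (hB.inter (cell_meas _ _)) hr] at this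
  have h := ENNReal.rpow_le_rpow this hs.le
  rw [eLpNorm_rpow_eq _ hs] at h
  refine h.trans (le_of_eq ?_)
  rw [ENNReal.mul_rpow_of_nonneg _ _ hs.le, ENNReal.mul_rpow_of_nonneg _ _ hs.le,
    ← ENNReal.rpow_mul, ← ENNReal.rpow_mul, mul_assoc, one_div_mul_eq_div]

lemma cell_sum_le (B : Set (ℝ × ℝ)) (hB : MeasurableSet B) (T : Finset (ℤ × ℤ)) :
    ∑ m ∈ T, volume (B ∩ cell m.1 m.2) ≤ volume B := by
  rw [← measure_biUnion_finset]
  · exact measure_mono (iUnion₂_subset fun _ _ => inter_subset_left)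
  · intro m _ n _ hmn
    refine Set.disjoint_left.2 fun ξ h1 h2 => hmn ?_
    exact Prod.ext (h1.2.1.symm.trans h2.2.1) (h1.2.2.symm.trans h2.2.2)
  · intro m _; exact hB.inter (cell_meas _ _)

lemma fiber_sum_le (S : Finset ((ℤ × ℤ) × (ℤ × ℤ)))
    (hS : ∀ i ∈ S, |i.1.1 - i.1.2| ≤ 3 ∧ |i.2.1 - i.2.2| ≤ 3) (F : ℤ → ℤ → ℝ≥0∞) (V : ℝ≥0∞)
    (hF : ∀ T : Finset (ℤ × ℤ), ∑ m ∈ T, F m.1 m.2 ≤ V) :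
    ∑ i ∈ S, (F i.1.1 i.2.1 + F i.1.2 i.2.2) ≤ 98 * V := by
  classical
  have gen : ∀ g g' : (ℤ × ℤ) × (ℤ × ℤ) → ℤ × ℤ, (∀ i ∈ S, |(g i).1 - (g' i).1| ≤ 3 ∧ |(g i).2 - (g' i).2| ≤ 3) →
      (∀ i j, g i = g j → g' i = g' j → i = j) → ∑ i ∈ S, F (g i).1 (g i).2 ≤ 49 * V := by
    intro g g' hg hinj
    rw [← Finset.sum_fiberwise_of_maps_to (t := S.image g) (g := g)
      (fun i hi => Finset.mem_image_of_mem g hi)]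
    calc _ ≤ ∑ m ∈ S.image g, 49 * F m.1 m.2 := by
          refine Finset.sum_le_sum fun m _ => ?_
          rw [Finset.sum_congr rfl (g := fun _ => F m.1 m.2)
            (fun i hi => by rw [(Finset.mem_filter.1 hi).2]), Finset.sum_const, nsmul_eq_mul]
          refine mul_le_mul_left ?_ _
          have : (S.filter fun i => g i = m).card ≤ 49 := by
            have hRc : (Finset.Icc (m.1 - 3) (m.1 + 3) ×ˢ Finset.Icc (m.2 - 3) (m.2 + 3)).card = 49 := by
              have : ∀ a : ℤ, (a + 3 + 1 - (a - 3)).toNat = 7 := by intro a; ring_nf; rfl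
              simp only [Finset.card_product, Int.card_Icc, this]
            rw [← hRc]
            refine Finset.card_le_card_of_injOn g' ?_ ?_
            · intro i hi
              have hi' := Finset.mem_filter.1 hi
              have := hg i hi'.1
              rw [hi'.2] at this
              simp only [abs_le] at this
              simp only [Finset.coe_product, Finset.coe_Icc, mem_prod, mem_Icc]
              omega
            · intro i hi j hj hij
              exact hinj i j ((Finset.mem_filter.1 hi).2.trans (Finset.mem_filter.1 hj).2.symm) hij
          exact_mod_cast this
      _ = 49 * ∑ m ∈ S.image g, F m.1 m.2 := by rw [Finset.mul_sum]
      _ ≤ _ := mul_le_mul_right (hF _) _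
  rw [Finset.sum_add_distrib]
  have e1 := gen (fun i => (i.1.1, i.2.1)) (fun i => (i.1.2, i.2.2)) hS
    (fun i j h1 h2 => by
      simp only [Prod.mk.injEq] at h1 h2
      exact Prod.ext (Prod.ext h1.1 h2.1) (Prod.ext h1.2 h2.2))
  have e2 := gen (fun i => (i.1.2, i.2.2)) (fun i => (i.1.1, i.2.1))
    (fun i hi => by
      have := hS i hi
      exact ⟨by rw [abs_sub_comm]; exact this.1, by rw [abs_sub_comm]; exact this.2⟩)
    (fun i j h1 h2 => by
      simp only [Prod.mk.injEq] at h1 h2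
      exact Prod.ext (Prod.ext h2.1 h1.1) (Prod.ext h2.2 h1.2))
  refine (add_le_add e1 e2).trans (le_of_eq ?_)
  rw [← add_mul]; norm_num

lemma rpow_split_le {a b M : ℝ≥0∞} {q : ℝ} (hq : 1 < q) (ha : a ≤ M) (hb : b ≤ M) :
    a ^ (q / 2) * b ^ (q / 2) ≤ M ^ (q - 1) * (a + b) := by
  have one : ∀ c : ℝ≥0∞, c ≤ M → c ^ q ≤ M ^ (q - 1) * c := by
    intro c hc
    calc c ^ q = c ^ ((q - 1) + 1) := by ring_nf
      _ = c ^ (q - 1) * c := by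
        rw [ENNReal.rpow_add_of_nonneg _ _ (by linarith) (by norm_num), ENNReal.rpow_one]
      _ ≤ _ := mul_le_mul_left (ENNReal.rpow_le_rpow hc (by linarith)) _
  have sq : ∀ c : ℝ≥0∞, c ^ (q / 2) * c ^ (q / 2) = c ^ q := by
    intro c
    rw [← ENNReal.rpow_add_of_nonneg _ _ (by linarith) (by linarith)]; ring_nf
  rcases le_total a b with h | h
  · calc _ ≤ b ^ (q / 2) * b ^ (q / 2) := mul_le_mul_left (ENNReal.rpow_le_rpow h (by linarith)) _
      _ = b ^ q := sq b
      _ ≤ M ^ (q - 1) * b := one b hb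
      _ ≤ _ := mul_le_mul_right le_add_self _
  · calc _ ≤ a ^ (q / 2) * a ^ (q / 2) := mul_le_mul_right (ENNReal.rpow_le_rpow h (by linarith)) _
      _ = a ^ q := sq a
      _ ≤ M ^ (q - 1) * a := one a ha
      _ ≤ _ := mul_le_mul_right le_self_add _

lemma unit_bound (s r A : ℝ) (hs₁ : 1 < s) (hs₂ : s < 2) (hr : 0 < r) (hq : 1 < 2 * s / r)
    (hBH : BH s r A) : ∃ K : ℝ≥0∞, K ≠ ⊤ ∧
    ∀ (B : Set (ℝ × ℝ)) (_ : MeasurableSet B) (S : Finset ((ℤ × ℤ) × (ℤ × ℤ)))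
      (_ : ∀ i ∈ S, 2 ≤ |i.1.1 - i.1.2| ∧ |i.1.1 - i.1.2| ≤ 3 ∧ 2 ≤ |i.2.1 - i.2.2| ∧ |i.2.1 - i.2.2| ≤ 3)
      (M : ℝ≥0∞) (_ : ∀ m₁ m₂, volume (B ∩ cell m₁ m₂) ≤ M),
      ∫⁻ p, ‖∑ i ∈ S, piece B i p‖ₑ ^ s ≤ K * (M ^ (2 * s / r - 1) * volume B) := by
  obtain ⟨K, hK, h⟩ := unit_orth s hs₁ hs₂
  refine ⟨K * (ENNReal.ofReal A ^ s * 98), ENNReal.mul_ne_top hK (ENNReal.mul_ne_top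
    (ENNReal.rpow_ne_top_of_nonneg (by linarith) ENNReal.ofReal_ne_top) (by norm_num)), ?_⟩
  intro B hB S hS M hM
  have hS' : ∀ i ∈ S, |i.1.1 - i.1.2| ≤ 3 ∧ |i.2.1 - i.2.2| ≤ 3 := fun i hi => ⟨(hS i hi).2.1, (hS i hi).2.2.2⟩
  refine (h B hB S hS').trans ?_
  rw [mul_assoc]
  refine mul_le_mul_right ?_ _
  calc ∑ i ∈ S, ∫⁻ p, ‖piece B i p‖ₑ ^ s
      ≤ ∑ i ∈ S, ENNReal.ofReal A ^ s * (M ^ (2 * s / r - 1) *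
        (volume (B ∩ cell i.1.1 i.2.1) + volume (B ∩ cell i.1.2 i.2.2))) := by
        refine Finset.sum_le_sum fun i hi => ?_
        refine (piece_bound (by linarith) hr hBH hB i (hS i hi)).trans (mul_le_mul_right ?_ _)
        have := rpow_split_le hq (hM i.1.1 i.2.1) (hM i.1.2 i.2.2)
        rwa [show 2 * s / r / 2 = s / r by ring] at this
    _ = ENNReal.ofReal A ^ s * (M ^ (2 * s / r - 1) *
        ∑ i ∈ S, (volume (B ∩ cell i.1.1 i.2.1) + volume (B ∩ cell i.1.2 i.2.2))) := by
        rw [Finset.mul_sum, Finset.mul_sum]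
    _ ≤ ENNReal.ofReal A ^ s * (M ^ (2 * s / r - 1) * (98 * volume B)) := by
        refine mul_le_mul_right (mul_le_mul_right ?_ _) _
        exact fiber_sum_le S hS' (fun a b => volume (B ∩ cell a b)) _ (cell_sum_le B hB)
    _ = _ := by ring

open MeasureTheory Set
open scoped ENNReal

lemma map_scale2 {a b : ℝ} (ha : 0 < a) (hb : 0 < b) :
    Measure.map (Prod.map (a * ·) (b * ·)) (volume : Measure (ℝ × ℝ)) =
      ENNReal.ofReal ((a * b)⁻¹) • volume := by
  rw [Measure.volume_eq_prod, ← Measure.map_prod_map _ _ (measurable_const_mul a) (measurable_const_mul b),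
    Real.map_volume_mul_left ha.ne', Real.map_volume_mul_left hb.ne', Measure.prod_smul_left,
    Measure.prod_smul_right, smul_smul, abs_of_pos (by positivity), abs_of_pos (by positivity),
    ← ENNReal.ofReal_mul (by positivity), mul_inv]

lemma map_scale3 {a b c : ℝ} (ha : 0 < a) (hb : 0 < b) (hc : 0 < c) :
    Measure.map (Prod.map (c * ·) (Prod.map (a * ·) (b * ·))) (volume : Measure (ℝ × ℝ × ℝ)) =
      ENNReal.ofReal (c⁻¹ * (a * b)⁻¹) • volume := by
  have hm : Measurable (Prod.map (a * ·) (b * ·) : ℝ × ℝ → ℝ × ℝ) :=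
    (measurable_const_mul a).prodMap (measurable_const_mul b)
  rw [Measure.volume_eq_prod, ← Measure.map_prod_map _ _ (measurable_const_mul c) hm,
    Real.map_volume_mul_left hc.ne', map_scale2 ha hb, Measure.prod_smul_left,
    Measure.prod_smul_right, smul_smul, abs_of_pos (by positivity),
    ← ENNReal.ofReal_mul (by positivity)]

lemma mulLeft_emb {a : ℝ} (ha : 0 < a) : MeasurableEmbedding (a * · : ℝ → ℝ) :=
  (Homeomorph.mulLeft₀ a ha.ne').measurableEmbedding

lemma scale2_emb {a b : ℝ} (ha : 0 < a) (hb : 0 < b) :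
    MeasurableEmbedding (Prod.map (a * ·) (b * ·) : ℝ × ℝ → ℝ × ℝ) :=
  ((Homeomorph.mulLeft₀ a ha.ne').prodCongr (Homeomorph.mulLeft₀ b hb.ne')).measurableEmbedding

lemma volume_scale2 {a b : ℝ} (ha : 0 < a) (hb : 0 < b) (S : Set (ℝ × ℝ)) :
    volume (Prod.map (a * ·) (b * ·) ⁻¹' S) = ENNReal.ofReal ((a * b)⁻¹) * volume S := by
  rw [← (scale2_emb ha hb).map_apply, map_scale2 ha hb, Measure.smul_apply, smul_eq_mul]

lemma integral_scale2 {a b : ℝ} (ha : 0 < a) (hb : 0 < b) (g : ℝ × ℝ → ℂ) :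
    ∫ ξ : ℝ × ℝ, g (a * ξ.1, b * ξ.2) = ((a * b)⁻¹ : ℝ) • ∫ ξ, g ξ := by
  have := (scale2_emb ha hb).integral_map (μ := volume) g
  rw [map_scale2 ha hb, integral_smul_measure, ENNReal.toReal_ofReal (by positivity)] at this
  exact this.symm

lemma extOp_scale {a b : ℝ} (ha : 0 < a) (hb : 0 < b) (S : Set (ℝ × ℝ)) (p : ℝ × ℝ × ℝ) :
    extOp (chi (Prod.map (a * ·) (b * ·) ⁻¹' S)) p =
      ((a * b)⁻¹ : ℝ) • extOp (chi S) ((a * b)⁻¹ * p.1, a⁻¹ * p.2.1, b⁻¹ * p.2.2) := by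
  unfold extOp
  rw [← integral_scale2 ha hb]
  congr 1; ext ξ
  congr 1
  congr 3
  field_simp

/-- Half-open dyadic-type tiles with scales `1/a`, `1/b`. -/
def tl (a b : ℝ) (m₁ m₂ : ℤ) : Set (ℝ × ℝ) := {ξ | ⌊a * ξ.1⌋ = m₁ ∧ ⌊b * ξ.2⌋ = m₂}

lemma tl_meas (a b : ℝ) (m₁ m₂ : ℤ) : MeasurableSet (tl a b m₁ m₂) := by
  have : tl a b m₁ m₂ = Prod.map (a * ·) (b * ·) ⁻¹' cell m₁ m₂ := rfl
  rw [this]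
  exact (((measurable_const_mul a).prodMap (measurable_const_mul b))) (cell_meas _ _)

/-- The rescaled bilinear pieces. -/
noncomputable def spiece (Ω : Set (ℝ × ℝ)) (a b : ℝ) (i : (ℤ × ℤ) × (ℤ × ℤ)) (p : ℝ × ℝ × ℝ) : ℂ :=
  extOp (chi (Ω ∩ tl a b i.1.1 i.2.1)) p * extOp (chi (Ω ∩ tl a b i.1.2 i.2.2)) p

lemma scaled_bound (s r A : ℝ) (hs₁ : 1 < s) (hs₂ : s < 2) (hr : 0 < r) (hq : 1 < 2 * s / r)
    (hBH : BH s r A) : ∃ K : ℝ≥0∞, K ≠ ⊤ ∧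
    ∀ (Ω : Set (ℝ × ℝ)) (_ : MeasurableSet Ω) (a b : ℝ) (_ : 0 < a) (_ : 0 < b)
      (S : Finset ((ℤ × ℤ) × (ℤ × ℤ)))
      (_ : ∀ i ∈ S, 2 ≤ |i.1.1 - i.1.2| ∧ |i.1.1 - i.1.2| ≤ 3 ∧ 2 ≤ |i.2.1 - i.2.2| ∧ |i.2.1 - i.2.2| ≤ 3)
      (M : ℝ≥0∞) (_ : ∀ m₁ m₂, volume (Ω ∩ tl a b m₁ m₂) ≤ M),
      ∫⁻ p, ‖∑ i ∈ S, spiece Ω a b i p‖ₑ ^ s ≤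
        K * (ENNReal.ofReal (a * b) ^ (2 * s / r - 2 * (s - 1)) * (M ^ (2 * s / r - 1) * volume Ω)) := by
  obtain ⟨K, hK, h⟩ := unit_bound s r A hs₁ hs₂ hr hq hBH
  refine ⟨K, hK, ?_⟩
  intro Ω hΩ a b ha hb S hS M hM
  set φ : ℝ × ℝ → ℝ × ℝ := Prod.map (a * ·) (b * ·) with hφ
  set B : Set (ℝ × ℝ) := Prod.map (a⁻¹ * ·) (b⁻¹ * ·) ⁻¹' Ω with hBdef
  have hB : MeasurableSet B :=
    ((measurable_const_mul a⁻¹).prodMap (measurable_const_mul b⁻¹)) hΩ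
  have hpre : φ ⁻¹' B = Ω := by
    ext ξ
    simp only [hφ, hBdef, mem_preimage, Prod.map]
    rw [inv_mul_cancel_left₀ ha.ne', inv_mul_cancel_left₀ hb.ne']
  have hcell : ∀ m₁ m₂, Ω ∩ tl a b m₁ m₂ = φ ⁻¹' (B ∩ cell m₁ m₂) := by
    intro m₁ m₂
    rw [preimage_inter, hpre]; rfl
  set l : ℝ≥0∞ := ENNReal.ofReal (a * b) with hl
  have hl0 : l ≠ 0 := by rw [hl]; simp; positivity
  have hlt : l ≠ ⊤ := ENNReal.ofReal_ne_top
  have hlinv : ENNReal.ofReal ((a * b)⁻¹) = l⁻¹ := ENNReal.ofReal_inv_of_pos (by positivity)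
  have hvB : ∀ S : Set (ℝ × ℝ), volume S = l * volume (φ ⁻¹' S) := by
    intro S
    rw [volume_scale2 ha hb, hlinv, ← mul_assoc, ENNReal.mul_inv_cancel hl0 hlt, one_mul]
  have hMB : ∀ m₁ m₂, volume (B ∩ cell m₁ m₂) ≤ l * M := by
    intro m₁ m₂
    rw [hvB, ← hcell]
    exact mul_le_mul_right (hM _ _) _
  have hu := h B hB S hS (l * M) hMB
  have hsp : ∀ p, ∑ i ∈ S, spiece Ω a b i p = (((a * b)⁻¹ ^ 2 : ℝ) : ℂ) *
      ∑ i ∈ S, piece B i ((a * b)⁻¹ * p.1, a⁻¹ * p.2.1, b⁻¹ * p.2.2) := by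
    intro p
    rw [Finset.mul_sum]
    refine Finset.sum_congr rfl fun i _ => ?_
    unfold spiece piece
    rw [hcell, hcell, hφ, extOp_scale ha hb, extOp_scale ha hb]
    simp only [Complex.real_smul]
    push_cast; ring
  have hm : Continuous fun p => ∑ i ∈ S, piece B i p :=
    continuous_finsetSum _ fun i _ => piece_cont hB i
  have hs0 : 0 < s := by linarith
  have hintg : ∫⁻ p, ‖∑ i ∈ S, spiece Ω a b i p‖ₑ ^ s =
      (l⁻¹ ^ (2 : ℝ)) ^ s * (l ^ (2 : ℝ) * ∫⁻ p, ‖∑ i ∈ S, piece B i p‖ₑ ^ s) := by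
    have e1 : ∀ p, ‖∑ i ∈ S, spiece Ω a b i p‖ₑ ^ s = (l⁻¹ ^ (2 : ℝ)) ^ s *
        ‖∑ i ∈ S, piece B i ((a * b)⁻¹ * p.1, a⁻¹ * p.2.1, b⁻¹ * p.2.2)‖ₑ ^ s := by
      intro p
      rw [hsp, enorm_mul, ENNReal.mul_rpow_of_nonneg _ _ hs0.le]
      congr 2
      rw [← ofReal_norm, Complex.norm_real, Real.norm_of_nonneg (by positivity),
        ENNReal.ofReal_pow (by positivity), hlinv, ENNReal.rpow_two]
    simp_rw [e1]
    rw [lintegral_const_mul' _ _ (ENNReal.rpow_ne_top_of_nonneg hs0.le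
      (ENNReal.rpow_ne_top_of_nonneg (by norm_num) (ENNReal.inv_ne_top.2 hl0)))]
    congr 1
    have := lintegral_map (μ := (volume : Measure (ℝ × ℝ × ℝ)))
      (f := fun p => ‖∑ i ∈ S, piece B i p‖ₑ ^ s)
      (g := Prod.map ((a * b)⁻¹ * ·) (Prod.map (a⁻¹ * ·) (b⁻¹ * ·)))
      (hm.measurable.enorm.pow_const s)
      ((measurable_const_mul _).prodMap ((measurable_const_mul _).prodMap (measurable_const_mul _)))
    rw [map_scale3 (by positivity) (by positivity) (by positivity), lintegral_smul_measure] at this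
    refine Eq.trans this.symm ?_
    rw [smul_eq_mul]
    congr 1
    rw [hl, ENNReal.rpow_two, ← ENNReal.ofReal_pow (by positivity)]
    congr 1
    field_simp
  rw [hintg]
  calc _ ≤ (l⁻¹ ^ (2 : ℝ)) ^ s * (l ^ (2 : ℝ) * (K * ((l * M) ^ (2 * s / r - 1) * (l * volume Ω)))) := by
        refine mul_le_mul_right (mul_le_mul_right ?_ _) _
        rw [hvB B, hpre] at hu
        exact hu
    _ = _ := by
        rw [ENNReal.mul_rpow_of_nonneg _ _ (by linarith : 0 ≤ 2 * s / r - 1), ← ENNReal.rpow_mul,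
          ENNReal.inv_rpow, ← ENNReal.rpow_neg]
        have : l ^ (2 * s / r - 2 * (s - 1)) = l ^ (-(2 * s)) * l ^ (2 : ℝ) * l ^ (2 * s / r - 1) * l := by
          conv_rhs => rw [← ENNReal.rpow_one l, ← ENNReal.rpow_mul, ← ENNReal.rpow_mul, ← ENNReal.rpow_mul]
          rw [← ENNReal.rpow_add _ _ hl0 hlt, ← ENNReal.rpow_add _ _ hl0 hlt, ← ENNReal.rpow_add _ _ hl0 hlt]
          congr 1; ring
        rw [this]; ring

open MeasureTheory Set
open scoped ENNReal

/-- Whitney relation between integers (indices of dyadic intervals). -/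
def Wh (a b : ℤ) : Prop := 2 ≤ |a - b| ∧ |a / 2 - b / 2| ≤ 1

instance (a b : ℤ) : Decidable (Wh a b) := by unfold Wh; infer_instance

lemma Wh_le {a b : ℤ} (h : Wh a b) : |a - b| ≤ 3 := by
  have := h.2
  rw [abs_le] at this ⊢
  omega

lemma Wh_step (a b : ℤ) : (if 2 ≤ |a / 2 - b / 2| then (1 : ℂ) else 0) + (if Wh a b then 1 else 0) =
    if 2 ≤ |a - b| then 1 else 0 := by
  unfold Wh
  by_cases h1 : 2 ≤ |a / 2 - b / 2|
  · have h2 : 2 ≤ |a - b| := by rw [le_abs] at h1 ⊢; omega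
    have h3 : ¬ |a / 2 - b / 2| ≤ 1 := by omega
    simp [h1, h2, h3]
  · have h3 : |a / 2 - b / 2| ≤ 1 := by omega
    simp [h1, h3]

lemma floor_half (n : ℕ) (x : ℝ) : ⌊(2 : ℝ) ^ (n + 1) * x⌋ / 2 = ⌊(2 : ℝ) ^ n * x⌋ := by
  have h := Int.floor_div_natCast ((2 : ℝ) ^ (n + 1) * x) 2
  rw [show (2 : ℝ) ^ (n + 1) * x / (2 : ℕ) = 2 ^ n * x by push_cast; ring] at h
  exact h.symm

/-- Whitney weight at level `n`. -/
noncomputable def whw (n : ℕ) (x y : ℝ) : ℂ := if Wh ⌊(2 : ℝ) ^ n * x⌋ ⌊(2 : ℝ) ^ n * y⌋ then 1 else 0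

lemma whw_sum {x y : ℝ} (hx : x ∈ Icc (0 : ℝ) 1) (hy : y ∈ Icc (0 : ℝ) 1) (N : ℕ) :
    ∑ n ∈ Finset.range N, whw (n + 1) x y =
      if 2 ≤ |⌊(2 : ℝ) ^ N * x⌋ - ⌊(2 : ℝ) ^ N * y⌋| then 1 else 0 := by
  induction N with
  | zero =>
    have h : ∀ u ∈ Icc (0 : ℝ) 1, 0 ≤ ⌊u⌋ ∧ ⌊u⌋ ≤ 1 := fun u hu =>
      ⟨Int.floor_nonneg.2 hu.1, Int.floor_le_iff.2 (by push_cast; linarith [hu.2])⟩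
    have h1 := h x hx
    have h2 := h y hy
    have : ¬ 2 ≤ |⌊x⌋ - ⌊y⌋| := by rw [not_le, abs_lt]; omega
    simp [this]
  | succ N ih =>
    rw [Finset.sum_range_succ, ih, whw, ← floor_half N x, ← floor_half N y, Wh_step]

lemma floor_sep {x y : ℝ} (h : x ≠ y) : ∀ᶠ N : ℕ in Filter.atTop,
    2 ≤ |⌊(2 : ℝ) ^ N * x⌋ - ⌊(2 : ℝ) ^ N * y⌋| := by
  have h0 : 0 < |x - y| := abs_pos.2 (sub_ne_zero.2 h)
  have ht : Filter.Tendsto (fun N : ℕ => (2 : ℝ) ^ N * |x - y|) Filter.atTop Filter.atTop :=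
    (tendsto_pow_atTop_atTop_of_one_lt (by norm_num)).atTop_mul_const h0
  filter_upwards [ht.eventually_ge_atTop 3] with N hN
  have : (2 : ℝ) ^ N * |x - y| = |(2 : ℝ) ^ N * x - 2 ^ N * y| := by
    rw [← mul_sub, abs_mul, abs_of_pos (by positivity : (0 : ℝ) < 2 ^ N)]
  rw [this] at hN
  have a1 := Int.floor_le ((2 : ℝ) ^ N * x)
  have a2 := Int.lt_floor_add_one ((2 : ℝ) ^ N * x)
  have b1 := Int.floor_le ((2 : ℝ) ^ N * y)
  have b2 := Int.lt_floor_add_one ((2 : ℝ) ^ N * y)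
  rw [le_abs] at hN ⊢
  rcases hN with hN | hN
  · left
    have : (1 : ℝ) < ((⌊(2 : ℝ) ^ N * x⌋ - ⌊(2 : ℝ) ^ N * y⌋ : ℤ) : ℝ) := by push_cast; linarith
    have : (1 : ℤ) < ⌊(2 : ℝ) ^ N * x⌋ - ⌊(2 : ℝ) ^ N * y⌋ := by exact_mod_cast this
    omega
  · right
    have : ((⌊(2 : ℝ) ^ N * x⌋ - ⌊(2 : ℝ) ^ N * y⌋ : ℤ) : ℝ) < -1 := by push_cast; linarith
    have : ⌊(2 : ℝ) ^ N * x⌋ - ⌊(2 : ℝ) ^ N * y⌋ < (-1 : ℤ) := by exact_mod_cast this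
    omega

/-- Whitney pairs at level `n`. -/
noncomputable def whP (n : ℕ) : Finset (ℤ × ℤ) :=
  (Finset.Icc 0 (2 ^ n) ×ˢ Finset.Icc 0 (2 ^ n)).filter fun m => Wh m.1 m.2

lemma floor_range (n : ℕ) {x : ℝ} (hx : x ∈ Icc (0 : ℝ) 1) :
    0 ≤ ⌊(2 : ℝ) ^ n * x⌋ ∧ ⌊(2 : ℝ) ^ n * x⌋ ≤ 2 ^ n := by
  refine ⟨Int.floor_nonneg.2 (mul_nonneg (by positivity) hx.1), ?_⟩
  have : (⌊(2 : ℝ) ^ n * x⌋ : ℝ) ≤ 2 ^ n :=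
    (Int.floor_le _).trans (mul_le_of_le_one_right (by positivity) hx.2)
  exact_mod_cast this

lemma whP_mem (n : ℕ) {x y : ℝ} (hx : x ∈ Icc (0 : ℝ) 1) (hy : y ∈ Icc (0 : ℝ) 1) :
    (⌊(2 : ℝ) ^ n * x⌋, ⌊(2 : ℝ) ^ n * y⌋) ∈ whP n ↔ Wh ⌊(2 : ℝ) ^ n * x⌋ ⌊(2 : ℝ) ^ n * y⌋ := by
  unfold whP
  rw [Finset.mem_filter, Finset.mem_product, Finset.mem_Icc, Finset.mem_Icc]
  exact ⟨fun h => h.2, fun h => ⟨⟨floor_range n hx, floor_range n hy⟩, h⟩⟩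

lemma ite_mul_ite_and {P Q R : Prop} [Decidable P] [Decidable Q] [Decidable R] (h : R ↔ P ∧ Q) :
    (if P then (1 : ℂ) else 0) * (if Q then 1 else 0) = if R then 1 else 0 := by
  by_cases hP : P <;> by_cases hQ : Q <;> simp [h, hP, hQ]

lemma chi_sum {Ω : Set (ℝ × ℝ)} (hΩ : Ω ⊆ Icc 0 1 ×ˢ Icc 0 1) (j k : ℕ) (z : (ℝ × ℝ) × (ℝ × ℝ)) :
    ∑ i ∈ whP j ×ˢ whP k, chi (Ω ∩ tl (2 ^ j) (2 ^ k) i.1.1 i.2.1) z.1 *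
      chi (Ω ∩ tl (2 ^ j) (2 ^ k) i.1.2 i.2.2) z.2 =
    chi Ω z.1 * chi Ω z.2 * (whw j z.1.1 z.2.1 * whw k z.1.2 z.2.2) := by
  classical
  by_cases h1 : z.1 ∈ Ω
  swap
  · have : ∀ S, chi (Ω ∩ S) z.1 = 0 := fun S => indicator_of_notMem (fun h => h1 h.1) _
    have h : chi Ω z.1 = 0 := indicator_of_notMem h1 _
    simp [this, h]
  by_cases h2 : z.2 ∈ Ω
  swap
  · have : ∀ S, chi (Ω ∩ S) z.2 = 0 := fun S => indicator_of_notMem (fun h => h2 h.1) _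
    have h : chi Ω z.2 = 0 := indicator_of_notMem h2 _
    simp [this, h]
  have e1 : chi Ω z.1 = 1 := indicator_of_mem h1 _
  have e2 : chi Ω z.2 = 1 := indicator_of_mem h2 _
  rw [e1, e2, one_mul, one_mul]
  set i0 : (ℤ × ℤ) × (ℤ × ℤ) := ((⌊(2 : ℝ) ^ j * z.1.1⌋, ⌊(2 : ℝ) ^ j * z.2.1⌋),
    (⌊(2 : ℝ) ^ k * z.1.2⌋, ⌊(2 : ℝ) ^ k * z.2.2⌋)) with hi0
  have hterm : ∀ i : (ℤ × ℤ) × (ℤ × ℤ), chi (Ω ∩ tl (2 ^ j) (2 ^ k) i.1.1 i.2.1) z.1 *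
      chi (Ω ∩ tl (2 ^ j) (2 ^ k) i.1.2 i.2.2) z.2 = if i0 = i then 1 else 0 := by
    rintro ⟨⟨a, a'⟩, ⟨b, b'⟩⟩
    have c1 : z.1 ∈ Ω ∩ tl (2 ^ j) (2 ^ k) a b ↔ ⌊(2 : ℝ) ^ j * z.1.1⌋ = a ∧ ⌊(2 : ℝ) ^ k * z.1.2⌋ = b :=
      ⟨fun h => h.2, fun h => ⟨h1, h⟩⟩
    have c2 : z.2 ∈ Ω ∩ tl (2 ^ j) (2 ^ k) a' b' ↔ ⌊(2 : ℝ) ^ j * z.2.1⌋ = a' ∧ ⌊(2 : ℝ) ^ k * z.2.2⌋ = b' :=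
      ⟨fun h => h.2, fun h => ⟨h2, h⟩⟩
    simp only [chi, indicator]
    refine ite_mul_ite_and ?_
    rw [c1, c2, hi0]
    simp only [Prod.mk.injEq]
    clear c1 c2 hi0 e1 e2
    constructor
    · rintro ⟨⟨u1, u2⟩, u3, u4⟩
      exact ⟨⟨u1, u3⟩, u2, u4⟩
    · rintro ⟨⟨u1, u2⟩, u3, u4⟩
      exact ⟨⟨u1, u3⟩, u2, u4⟩
  rw [Finset.sum_congr rfl fun i _ => hterm i, Finset.sum_ite_eq]
  have hmem : i0 ∈ whP j ×ˢ whP k ↔ Wh ⌊(2 : ℝ) ^ j * z.1.1⌋ ⌊(2 : ℝ) ^ j * z.2.1⌋ ∧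
      Wh ⌊(2 : ℝ) ^ k * z.1.2⌋ ⌊(2 : ℝ) ^ k * z.2.2⌋ := by
    rw [Finset.mem_product, hi0, whP_mem j (hΩ h1).1 (hΩ h2).1, whP_mem k (hΩ h1).2 (hΩ h2).2]
  unfold whw
  exact (ite_mul_ite_and hmem).symm

/-- The oscillating factor. -/
noncomputable def ph (p : ℝ × ℝ × ℝ) (ξ : ℝ × ℝ) : ℂ :=
  Complex.exp (Complex.I * (p.1 * ξ.1 * ξ.2 + p.2.1 * ξ.1 + p.2.2 * ξ.2 : ℝ))

lemma ph_chi_integrable {S : Set (ℝ × ℝ)} (hS : MeasurableSet S) (hv : volume S ≠ ⊤) (p : ℝ × ℝ × ℝ) :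
    Integrable (fun ξ => ph p ξ * chi S ξ) volume := by
  have hf := chi_integrable hS hv
  refine hf.norm.mono' ?_ ?_
  · refine AEStronglyMeasurable.mul ?_ hf.aestronglyMeasurable
    apply Continuous.aestronglyMeasurable
    unfold ph
    fun_prop
  · refine Filter.Eventually.of_forall fun z => ?_
    rw [norm_mul, ph, norm_expI, one_mul]

lemma sq_vol_fin {Ω : Set (ℝ × ℝ)} (hΩ : Ω ⊆ Icc 0 1 ×ˢ Icc 0 1) : volume Ω ≠ ⊤ := by
  refine ((measure_mono hΩ).trans_lt ?_).ne
  rw [Measure.volume_eq_prod, Measure.prod_prod]; simp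

/-- The Whitney piece of the square of the extension. -/
noncomputable def GG (Ω : Set (ℝ × ℝ)) (j k : ℕ) (p : ℝ × ℝ × ℝ) : ℂ :=
  ∑ i ∈ whP j ×ˢ whP k, spiece Ω (2 ^ j) (2 ^ k) i p

lemma spiece_eq {Ω : Set (ℝ × ℝ)} (a b : ℝ) (i : (ℤ × ℤ) × (ℤ × ℤ)) (p : ℝ × ℝ × ℝ) :
    spiece Ω a b i p = ∫ z : (ℝ × ℝ) × (ℝ × ℝ), (ph p z.1 * chi (Ω ∩ tl a b i.1.1 i.2.1) z.1) *
      (ph p z.2 * chi (Ω ∩ tl a b i.1.2 i.2.2) z.2) := by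
  unfold spiece extOp
  rw [← integral_prod_mul]; rfl

lemma GG_eq {Ω : Set (ℝ × ℝ)} (hm : MeasurableSet Ω) (hΩ : Ω ⊆ Icc 0 1 ×ˢ Icc 0 1) (j k : ℕ)
    (p : ℝ × ℝ × ℝ) :
    Integrable (fun z : (ℝ × ℝ) × (ℝ × ℝ) => (ph p z.1 * chi Ω z.1) * (ph p z.2 * chi Ω z.2) *
      (whw j z.1.1 z.2.1 * whw k z.1.2 z.2.2)) ∧
    GG Ω j k p = ∫ z : (ℝ × ℝ) × (ℝ × ℝ), (ph p z.1 * chi Ω z.1) * (ph p z.2 * chi Ω z.2) *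
      (whw j z.1.1 z.2.1 * whw k z.1.2 z.2.2) := by
  have hintg : ∀ m n, Integrable (fun ξ => ph p ξ * chi (Ω ∩ tl (2 ^ j) (2 ^ k) m n) ξ) := fun m n =>
    ph_chi_integrable (hm.inter (tl_meas _ _ _ _))
      ((measure_mono inter_subset_left).trans_lt (sq_vol_fin hΩ).lt_top).ne p
  have hfun : (fun z : (ℝ × ℝ) × (ℝ × ℝ) => (ph p z.1 * chi Ω z.1) * (ph p z.2 * chi Ω z.2) *
      (whw j z.1.1 z.2.1 * whw k z.1.2 z.2.2)) = fun z => ∑ i ∈ whP j ×ˢ whP k,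
      (ph p z.1 * chi (Ω ∩ tl (2 ^ j) (2 ^ k) i.1.1 i.2.1) z.1) *
      (ph p z.2 * chi (Ω ∩ tl (2 ^ j) (2 ^ k) i.1.2 i.2.2) z.2) := by
    ext z
    have := chi_sum hΩ j k z
    calc _ = ph p z.1 * ph p z.2 * (chi Ω z.1 * chi Ω z.2 * (whw j z.1.1 z.2.1 * whw k z.1.2 z.2.2)) := by ring
      _ = _ := by
        rw [← this, Finset.mul_sum]
        exact Finset.sum_congr rfl fun i _ => by ring
  rw [hfun]
  have hi : ∀ i ∈ whP j ×ˢ whP k, Integrable (fun z : (ℝ × ℝ) × (ℝ × ℝ) =>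
      (ph p z.1 * chi (Ω ∩ tl (2 ^ j) (2 ^ k) i.1.1 i.2.1) z.1) *
      (ph p z.2 * chi (Ω ∩ tl (2 ^ j) (2 ^ k) i.1.2 i.2.2) z.2)) := fun i _ =>
    (hintg _ _).mul_prod (hintg _ _)
  refine ⟨integrable_finsetSum _ hi, ?_⟩
  rw [integral_finsetSum _ hi]
  unfold GG
  exact Finset.sum_congr rfl fun i _ => spiece_eq _ _ _ _

lemma ae_ne_of_proj (g : ℝ × ℝ → ℝ) (hg : Measurable g) (hz : ∀ c, volume (g ⁻¹' {c}) = 0) :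
    ∀ᵐ z : (ℝ × ℝ) × (ℝ × ℝ), g z.1 ≠ g z.2 := by
  rw [ae_iff]
  have hms : MeasurableSet {z : (ℝ × ℝ) × (ℝ × ℝ) | g z.1 = g z.2} :=
    measurableSet_eq_fun (hg.comp measurable_fst) (hg.comp measurable_snd)
  simp only [ne_eq, not_not]
  rw [Measure.volume_eq_prod, Measure.measure_prod_null hms]
  refine Filter.Eventually.of_forall fun u => ?_
  have : Prod.mk u ⁻¹' {z : (ℝ × ℝ) × (ℝ × ℝ) | g z.1 = g z.2} = g ⁻¹' {g u} := by
    ext v; simp [eq_comm]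
  change volume (Prod.mk u ⁻¹' {z : (ℝ × ℝ) × (ℝ × ℝ) | g z.1 = g z.2}) = 0
  rw [this, hz]

lemma ae_ne1 : ∀ᵐ z : (ℝ × ℝ) × (ℝ × ℝ), z.1.1 ≠ z.2.1 := by
  refine ae_ne_of_proj Prod.fst measurable_fst fun c => ?_
  have : (Prod.fst ⁻¹' {c} : Set (ℝ × ℝ)) = {c} ×ˢ univ := by ext; simp
  rw [this, Measure.volume_eq_prod, Measure.prod_prod]; simp

lemma ae_ne2 : ∀ᵐ z : (ℝ × ℝ) × (ℝ × ℝ), z.1.2 ≠ z.2.2 := by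
  refine ae_ne_of_proj Prod.snd measurable_snd fun c => ?_
  have : (Prod.snd ⁻¹' {c} : Set (ℝ × ℝ)) = univ ×ˢ {c} := by ext; simp
  rw [this, Measure.volume_eq_prod, Measure.prod_prod]; simp

lemma GG_tendsto {Ω : Set (ℝ × ℝ)} (hm : MeasurableSet Ω) (hΩ : Ω ⊆ Icc 0 1 ×ˢ Icc 0 1)
    (p : ℝ × ℝ × ℝ) : Filter.Tendsto (fun N : ℕ => ∑ i ∈ Finset.range N ×ˢ Finset.range N,
      GG Ω (i.1 + 1) (i.2 + 1) p) Filter.atTop (nhds (extOp (chi Ω) p ^ 2)) := by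
  set D : ℕ → ℝ → ℝ → ℂ := fun N x y =>
    if 2 ≤ |⌊(2 : ℝ) ^ N * x⌋ - ⌊(2 : ℝ) ^ N * y⌋| then 1 else 0 with hD
  have hI := ph_chi_integrable hm (sq_vol_fin hΩ) p
  have hfun : ∀ N : ℕ, ∀ z : (ℝ × ℝ) × (ℝ × ℝ), ∑ i ∈ Finset.range N ×ˢ Finset.range N,
      (ph p z.1 * chi Ω z.1) * (ph p z.2 * chi Ω z.2) *
      (whw (i.1 + 1) z.1.1 z.2.1 * whw (i.2 + 1) z.1.2 z.2.2) =
      (ph p z.1 * chi Ω z.1) * (ph p z.2 * chi Ω z.2) * (D N z.1.1 z.2.1 * D N z.1.2 z.2.2) := by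
    intro N z
    by_cases h1 : z.1 ∈ Ω
    swap
    · have h : chi Ω z.1 = 0 := indicator_of_notMem h1 _
      simp [h]
    by_cases h2 : z.2 ∈ Ω
    swap
    · have h : chi Ω z.2 = 0 := indicator_of_notMem h2 _
      simp [h]
    rw [← Finset.mul_sum, Finset.sum_product]
    dsimp only
    rw [← Finset.sum_mul_sum,
      whw_sum (hΩ h1).1 (hΩ h2).1, whw_sum (hΩ h1).2 (hΩ h2).2]
  have heq : ∀ N : ℕ, ∑ i ∈ Finset.range N ×ˢ Finset.range N, GG Ω (i.1 + 1) (i.2 + 1) p =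
      ∫ z : (ℝ × ℝ) × (ℝ × ℝ), (ph p z.1 * chi Ω z.1) * (ph p z.2 * chi Ω z.2) *
        (D N z.1.1 z.2.1 * D N z.1.2 z.2.2) := by
    intro N
    rw [Finset.sum_congr rfl fun i _ => (GG_eq hm hΩ (i.1 + 1) (i.2 + 1) p).2,
      ← integral_finsetSum _ fun i _ => (GG_eq hm hΩ (i.1 + 1) (i.2 + 1) p).1]
    simp_rw [hfun]
  have hlim : extOp (chi Ω) p ^ 2 = ∫ z : (ℝ × ℝ) × (ℝ × ℝ),
      (ph p z.1 * chi Ω z.1) * (ph p z.2 * chi Ω z.2) := by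
    rw [sq]; unfold extOp; rw [← integral_prod_mul]; rfl
  simp_rw [heq]
  rw [hlim]
  have hII := hI.mul_prod hI
  refine tendsto_integral_of_dominated_convergence
    (fun z : (ℝ × ℝ) × (ℝ × ℝ) => ‖(ph p z.1 * chi Ω z.1) * (ph p z.2 * chi Ω z.2)‖) ?_ hII.norm ?_ ?_
  · intro N
    have : Integrable (fun z : (ℝ × ℝ) × (ℝ × ℝ) => ∑ i ∈ Finset.range N ×ˢ Finset.range N,
      (ph p z.1 * chi Ω z.1) * (ph p z.2 * chi Ω z.2) *
      (whw (i.1 + 1) z.1.1 z.2.1 * whw (i.2 + 1) z.1.2 z.2.2)) :=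
      integrable_finsetSum _ fun i _ => (GG_eq hm hΩ (i.1 + 1) (i.2 + 1) p).1
    simp_rw [hfun] at this
    exact this.aestronglyMeasurable
  · intro N
    refine Filter.Eventually.of_forall fun z => ?_
    rw [norm_mul]
    refine mul_le_of_le_one_right (norm_nonneg _) ?_
    have : ∀ x y, ‖D N x y‖ ≤ 1 := by
      intro x y; simp only [hD]; split_ifs <;> simp
    rw [norm_mul]
    exact mul_le_one₀ (this _ _) (norm_nonneg _) (this _ _)
  · filter_upwards [ae_ne1, ae_ne2] with z h1 h2
    refine tendsto_const_nhds.congr' ?_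
    filter_upwards [floor_sep h1, floor_sep h2] with N e1 e2
    simp only [hD, e1, e2, if_true, mul_one]

lemma GG_cont {Ω : Set (ℝ × ℝ)} (hm : MeasurableSet Ω) (hΩ : Ω ⊆ Icc 0 1 ×ˢ Icc 0 1) (j k : ℕ) :
    Continuous (GG Ω j k) := by
  have : ∀ m n, Continuous (extOp (chi (Ω ∩ tl (2 ^ j) (2 ^ k) m n))) := fun m n =>
    extOp_cont (chi_integrable (hm.inter (tl_meas _ _ _ _))
      ((measure_mono inter_subset_left).trans_lt (sq_vol_fin hΩ).lt_top).ne)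
  unfold GG spiece
  exact continuous_finsetSum _ fun i _ => (this _ _).mul (this _ _)

lemma extOp_sq_norm (f : ℝ × ℝ × ℝ → ℂ) {s : ℝ} (hs : 0 < s) :
    eLpNorm f (ENNReal.ofReal (2 * s)) volume ^ (2 : ℝ) =
      eLpNorm (fun p => f p ^ 2) (ENNReal.ofReal s) volume := by
  rw [eLpNorm_eq_lintegral_rpow_enorm_toReal (by simpa using hs) ENNReal.ofReal_ne_top,
    eLpNorm_eq_lintegral_rpow_enorm_toReal (by simpa using hs) ENNReal.ofReal_ne_top,
    ENNReal.toReal_ofReal hs.le, ENNReal.toReal_ofReal (by linarith), ← ENNReal.rpow_mul]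
  congr 1
  · refine lintegral_congr fun p => ?_
    rw [enorm_pow, ← ENNReal.rpow_two, ← ENNReal.rpow_mul]
  · field_simp

lemma whitney_bound {Ω : Set (ℝ × ℝ)} (hm : MeasurableSet Ω) (hΩ : Ω ⊆ Icc 0 1 ×ˢ Icc 0 1) {s : ℝ}
    (hs : 1 ≤ s) (V : ℝ≥0∞) (hV : ∀ N : ℕ, ∑ i ∈ Finset.range N ×ˢ Finset.range N,
      eLpNorm (GG Ω (i.1 + 1) (i.2 + 1)) (ENNReal.ofReal s) volume ≤ V) :
    eLpNorm (extOp (chi Ω)) (ENNReal.ofReal (2 * s)) volume ^ (2 : ℝ) ≤ V := by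
  rw [extOp_sq_norm _ (by linarith)]
  refine (Lp.eLpNorm_lim_le_liminf_eLpNorm (f := fun N p => ∑ i ∈ Finset.range N ×ˢ Finset.range N,
      GG Ω (i.1 + 1) (i.2 + 1) p) ?_ _
    (Filter.Eventually.of_forall fun p => GG_tendsto hm hΩ p)).trans ?_
  · intro N
    exact (continuous_finsetSum _ fun i _ => GG_cont hm hΩ _ _).aestronglyMeasurable
  · refine (Filter.liminf_le_liminf (v := fun _ => V) (Filter.Eventually.of_forall fun N => ?_)).trans ?_
    · refine le_trans ?_ (hV N)
      have := eLpNorm_sum_le (μ := (volume : Measure (ℝ × ℝ × ℝ))) (p := ENNReal.ofReal s)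
        (s := Finset.range N ×ˢ Finset.range N)
        (f := fun i => GG Ω (i.1 + 1) (i.2 + 1))
        (fun i _ => (GG_cont hm hΩ _ _).aestronglyMeasurable) (by simpa using hs)
      refine le_trans (le_of_eq ?_) this
      congr 1; ext p; simp
    · simp

open MeasureTheory Set
open scoped ENNReal

/-- Powers of two with real exponents, extended-nonnegative-valued. -/
noncomputable def e2 (x : ℝ) : ℝ≥0∞ := (2 : ℝ≥0∞) ^ x

lemma e2_ne_top (x : ℝ) : e2 x ≠ ⊤ := by
  unfold e2
  simp [ENNReal.rpow_eq_top_iff]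

lemma e2_ne_zero (x : ℝ) : e2 x ≠ 0 := by
  unfold e2
  simp [ENNReal.rpow_eq_zero_iff]

lemma e2_add (x y : ℝ) : e2 (x + y) = e2 x * e2 y :=
  ENNReal.rpow_add _ _ (by norm_num) (by norm_num)

lemma e2_rpow (x y : ℝ) : e2 x ^ y = e2 (x * y) := (ENNReal.rpow_mul _ _ _).symm

lemma e2_mono {x y : ℝ} (h : x ≤ y) : e2 x ≤ e2 y :=
  ENNReal.rpow_le_rpow_of_exponent_le (by norm_num) h

lemma e2_zero : e2 0 = 1 := ENNReal.rpow_zero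

lemma e2_two : e2 2 = 4 := by unfold e2; rw [ENNReal.rpow_two]; norm_num

lemma e2_zpow (n : ℤ) : (2 : ℝ≥0∞) ^ n = e2 n := (ENNReal.rpow_intCast _ _).symm

lemma e2_npow (n : ℕ) : (2 : ℝ≥0∞) ^ n = e2 n := (ENNReal.rpow_natCast _ _).symm

lemma e2_ofReal (x : ℝ) : ENNReal.ofReal ((2 : ℝ) ^ x) = e2 x := by
  unfold e2
  rw [← ENNReal.ofReal_rpow_of_pos (by norm_num)]; norm_num

lemma ofReal_two_pow (n : ℕ) : ENNReal.ofReal ((2 : ℝ) ^ n) = e2 n := by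
  rw [← e2_ofReal, Real.rpow_natCast]

/-! ### Measure bounds from fibers -/

lemma vol_le_of_fiber {S : Set (ℝ × ℝ)} (hS : MeasurableSet S) (T : Set ℝ) (c : ℝ≥0∞)
    (hT : ∀ x, (vFiber S x).Nonempty → x ∈ T) (hc : ∀ x, volume (vFiber S x) ≤ c) :
    volume S ≤ c * volume T := by
  rw [Measure.volume_eq_prod, Measure.prod_apply hS, ← measure_toMeasurable T,
    ← lintegral_indicator_const (measurableSet_toMeasurable _ _)]
  refine lintegral_mono fun x => ?_
  by_cases h : (vFiber S x).Nonempty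
  · rw [indicator_of_mem (subset_toMeasurable _ _ (hT x h))]
    exact hc x
  · have : Prod.mk x ⁻¹' S = ∅ := not_nonempty_iff_eq_empty.1 h
    simp [this]

lemma fiber_le_vol {S : Set (ℝ × ℝ)} (hS : MeasurableSet S) (c : ℝ≥0∞)
    (hc : ∀ x, (vFiber S x).Nonempty → c ≤ volume (vFiber S x)) :
    c * volume (Prod.fst '' S) ≤ volume S := by
  rw [Measure.volume_eq_prod, Measure.prod_apply hS]
  refine le_trans (mul_le_mul_right (measure_mono ?_) _)
    (mul_meas_ge_le_lintegral (measurable_measure_prodMk_left hS) c)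
  rintro x ⟨ξ, hξ, rfl⟩
  exact hc ξ.1 ⟨ξ.2, hξ⟩

lemma vol_floor_le (j : ℕ) (m : ℤ) : volume {x : ℝ | ⌊(2 : ℝ) ^ j * x⌋ = m} ≤ e2 (-(j : ℝ)) := by
  have hpos : (0 : ℝ) < 2 ^ j := by positivity
  have hsub : {x : ℝ | ⌊(2 : ℝ) ^ j * x⌋ = m} ⊆ Icc (m / 2 ^ j) ((m + 1) / 2 ^ j) := by
    intro x hx
    have h := Int.floor_eq_iff.1 hx
    constructor
    · rw [div_le_iff₀ hpos]; linarith [h.1]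
    · rw [le_div_iff₀ hpos]; linarith [h.2]
  refine (measure_mono hsub).trans ?_
  rw [Real.volume_Icc, ← e2_ofReal, Real.rpow_neg (by norm_num), Real.rpow_natCast]
  apply ENNReal.ofReal_le_ofReal
  apply le_of_eq; field_simp; ring

lemma floor_cover (j J : ℕ) (m : ℤ) : ∃ F : Finset ℤ, F.card ≤ 2 ^ (J - j) ∧
    ∀ x : ℝ, ⌊(2 : ℝ) ^ j * x⌋ = m → ⌊(2 : ℝ) ^ J * x⌋ ∈ F := by
  rcases le_total J j with h | h
  · obtain ⟨n, rfl⟩ := Nat.exists_eq_add_of_le h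
    refine ⟨{m / (2 ^ n : ℕ)}, by simp, fun x hx => ?_⟩
    have := Int.floor_div_natCast ((2 : ℝ) ^ (J + n) * x) (2 ^ n)
    rw [hx] at this
    rw [Finset.mem_singleton, ← this]
    congr 1
    rw [pow_add]; push_cast; field_simp
  · obtain ⟨n, rfl⟩ := Nat.exists_eq_add_of_le h
    refine ⟨Finset.Ico (m * 2 ^ n) ((m + 1) * 2 ^ n), ?_, fun x hx => ?_⟩
    · rw [Int.card_Ico]
      have : (m + 1) * 2 ^ n - m * 2 ^ n = ((2 ^ n : ℕ) : ℤ) := by push_cast; ring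
      rw [this, Int.toNat_natCast, Nat.add_sub_cancel_left]
    · have h := Int.floor_eq_iff.1 hx
      have hp : (0 : ℝ) < 2 ^ n := by positivity
      rw [Finset.mem_Ico]
      constructor
      · rw [Int.le_floor]; push_cast; rw [pow_add]; nlinarith [h.1]
      · rw [Int.floor_lt]; push_cast; rw [pow_add]; nlinarith [h.2]

lemma tl_cover_bound (Ω : Set (ℝ × ℝ)) (j k J K : ℕ) (D : ℝ≥0∞)
    (hD : ∀ n₁ n₂, volume (Ω ∩ tl (2 ^ J) (2 ^ K) n₁ n₂) ≤ D) (m₁ m₂ : ℤ) :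
    volume (Ω ∩ tl (2 ^ j) (2 ^ k) m₁ m₂) ≤ e2 (((J - j : ℕ) : ℝ) + ((K - k : ℕ) : ℝ)) * D := by
  obtain ⟨F₁, hc₁, hF₁⟩ := floor_cover j J m₁
  obtain ⟨F₂, hc₂, hF₂⟩ := floor_cover k K m₂
  have hsub : Ω ∩ tl (2 ^ j) (2 ^ k) m₁ m₂ ⊆ ⋃ n ∈ F₁ ×ˢ F₂, Ω ∩ tl (2 ^ J) (2 ^ K) n.1 n.2 := by
    rintro ξ ⟨h1, h2⟩
    refine mem_iUnion₂.2 ⟨(⌊(2 : ℝ) ^ J * ξ.1⌋, ⌊(2 : ℝ) ^ K * ξ.2⌋), ?_, h1, rfl, rfl⟩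
    exact Finset.mem_product.2 ⟨hF₁ _ h2.1, hF₂ _ h2.2⟩
  calc _ ≤ _ := measure_mono hsub
    _ ≤ ∑ n ∈ F₁ ×ˢ F₂, volume (Ω ∩ tl (2 ^ J) (2 ^ K) n.1 n.2) := measure_biUnion_finset_le _ _
    _ ≤ ∑ n ∈ F₁ ×ˢ F₂, D := Finset.sum_le_sum fun n _ => hD _ _
    _ = ((F₁.card * F₂.card : ℕ) : ℝ≥0∞) * D := by rw [Finset.sum_const, nsmul_eq_mul, Finset.card_product]
    _ ≤ _ := by
      refine mul_le_mul_left ?_ _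
      rw [e2_add, ← e2_npow, ← e2_npow]
      exact_mod_cast Nat.mul_le_mul hc₁ hc₂

/-- The standing hypotheses on `Ω`. -/
structure Hyp (Ω : Set (ℝ × ℝ)) (K J : ℕ) : Prop where
  meas : MeasurableSet Ω
  sub : Ω ⊆ Icc 0 1 ×ˢ Icc 0 1
  fib : ∀ x : ℝ, (vFiber Ω x).Nonempty →
          (2 : ℝ≥0∞) ^ (-(K : ℤ) - 1) ≤ volume (vFiber Ω x) ∧
            volume (vFiber Ω x) ≤ (2 : ℝ≥0∞) ^ (-(K : ℤ) + 1)
  lo : (2 : ℝ≥0∞) ^ (-(J : ℤ) - 1) ≤ volume (Prod.fst '' Ω)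
  hi : volume (Prod.fst '' Ω) ≤ (2 : ℝ≥0∞) ^ (-(J : ℤ) + 1)

section
variable {Ω : Set (ℝ × ℝ)} {K J : ℕ}

lemma Hyp.fib_hi (h : Hyp Ω K J) (x : ℝ) : volume (vFiber Ω x) ≤ e2 (-(K : ℝ) + 1) := by
  by_cases hx : (vFiber Ω x).Nonempty
  · refine (h.fib x hx).2.trans (le_of_eq ?_)
    rw [e2_zpow]; push_cast; rfl
  · rw [not_nonempty_iff_eq_empty.1 hx]; simp

lemma Hyp.pi_hi (h : Hyp Ω K J) : volume (Prod.fst '' Ω) ≤ e2 (-(J : ℝ) + 1) := by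
  refine h.hi.trans (le_of_eq ?_)
  rw [e2_zpow]; push_cast; rfl

lemma Hyp.vol_lo (h : Hyp Ω K J) : e2 (-(J : ℝ) - (K : ℝ) - 2) ≤ volume Ω := by
  refine le_trans ?_ (fiber_le_vol h.meas _ fun x hx => (h.fib x hx).1)
  refine le_trans (le_of_eq ?_) (mul_le_mul_right h.lo _)
  rw [e2_zpow, e2_zpow, ← e2_add]; push_cast; congr 1; ring

lemma Hyp.vol_hi (h : Hyp Ω K J) : volume Ω ≤ e2 (-(J : ℝ) - (K : ℝ) + 2) := by
  refine (vol_le_of_fiber h.meas (Prod.fst '' Ω) (e2 (-(K : ℝ) + 1)) ?_ h.fib_hi).trans ?_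
  · rintro x ⟨y, hy⟩; exact ⟨(x, y), hy, rfl⟩
  · refine (mul_le_mul_right h.pi_hi _).trans (le_of_eq ?_)
    rw [← e2_add]; congr 1; ring

lemma Hyp.tile_hi (h : Hyp Ω K J) (j k : ℕ) (m₁ m₂ : ℤ) : volume (Ω ∩ tl (2 ^ j) (2 ^ k) m₁ m₂) ≤
    e2 (2 - (j : ℝ) - ((J - j : ℕ) : ℝ) - (k : ℝ) - ((K - k : ℕ) : ℝ)) := by
  have one : ∀ (i I : ℕ) (v : ℝ≥0∞), v ≤ e2 (-(I : ℝ) + 1) → v ≤ e2 (-(i : ℝ)) →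
      v ≤ e2 (1 - (i : ℝ) - ((I - i : ℕ) : ℝ)) := by
    intro i I v h1 h2
    rcases le_total i I with hi | hi
    · refine h1.trans (e2_mono ?_)
      rw [Nat.cast_sub hi]; linarith
    · refine h2.trans (e2_mono ?_)
      rw [Nat.sub_eq_zero_of_le hi]; push_cast; linarith
  have hf : ∀ x, volume (vFiber (Ω ∩ tl (2 ^ j) (2 ^ k) m₁ m₂) x) ≤
      e2 (1 - (k : ℝ) - ((K - k : ℕ) : ℝ)) := by
    intro x
    refine one k K _ ((measure_mono ?_).trans (h.fib_hi x)) ((measure_mono ?_).trans (vol_floor_le k m₂))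
    · intro y hy; exact hy.1
    · intro y hy; exact hy.2.2
  have hp : volume (Prod.fst '' Ω ∩ {x : ℝ | ⌊(2 : ℝ) ^ j * x⌋ = m₁}) ≤
      e2 (1 - (j : ℝ) - ((J - j : ℕ) : ℝ)) :=
    one j J _ ((measure_mono inter_subset_left).trans h.pi_hi)
      ((measure_mono inter_subset_right).trans (vol_floor_le j m₁))
  refine (vol_le_of_fiber (h.meas.inter (tl_meas _ _ _ _)) _ _ ?_ hf).trans
    ((mul_le_mul_right hp _).trans (le_of_eq ?_))
  · rintro x ⟨y, hy⟩
    exact ⟨⟨(x, y), hy.1, rfl⟩, hy.2.1⟩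
  · rw [← e2_add]; congr 1; ring

end

/-! ### Summation -/

lemma geom_two_sided (κ : ℝ) (hκ : 0 < κ) : ∃ G : ℝ≥0∞, G ≠ ⊤ ∧ ∀ (N J : ℕ),
    ∑ n ∈ Finset.range N, e2 (-κ * |((n + 1 : ℕ) : ℝ) - J|) ≤ G := by
  set ρ := e2 (-κ) with hρ
  have hρ1 : ρ < 1 := by
    rw [hρ, e2]
    exact ENNReal.rpow_lt_one_of_one_lt_of_neg (by norm_num) (by linarith)
  set G0 := ∑' i : ℕ, ρ ^ i with hG0
  have hG0t : G0 ≠ ⊤ := by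
    rw [hG0, ENNReal.tsum_geometric]
    exact ENNReal.inv_ne_top.2 (tsub_pos_of_lt hρ1).ne'
  refine ⟨G0 + G0, ENNReal.add_ne_top.2 ⟨hG0t, hG0t⟩, fun N J => ?_⟩
  have hpow : ∀ i : ℕ, e2 (-κ * i) = ρ ^ i := by
    intro i
    rw [hρ, ← ENNReal.rpow_natCast, e2_rpow]
  have key : ∀ (T : Finset ℕ) (g : ℕ → ℕ), (∀ a ∈ T, ∀ b ∈ T, g a = g b → a = b) →
      ∑ n ∈ T, ρ ^ (g n) ≤ G0 := by
    intro T g hg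
    classical
    rw [← Finset.sum_image (f := fun i => ρ ^ i) (g := g) hg]
    exact ENNReal.sum_le_tsum _
  rw [← Finset.sum_filter_add_sum_filter_not (Finset.range N) (fun n => J ≤ n + 1)]
  refine add_le_add ?_ ?_
  · rw [Finset.sum_congr rfl (g := fun n => ρ ^ (n + 1 - J))]
    · refine key _ _ fun a ha b hb hab => ?_
      have := (Finset.mem_filter.1 ha).2
      have := (Finset.mem_filter.1 hb).2
      omega
    · intro n hn
      have h := (Finset.mem_filter.1 hn).2
      rw [← hpow, Nat.cast_sub h, abs_of_nonneg]
      have : (J : ℝ) ≤ ((n + 1 : ℕ) : ℝ) := by exact_mod_cast h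
      linarith
  · rw [Finset.sum_congr rfl (g := fun n => ρ ^ (J - (n + 1)))]
    · refine key _ _ fun a ha b hb hab => ?_
      have := (Finset.mem_filter.1 ha).2
      have := (Finset.mem_filter.1 hb).2
      omega
    · intro n hn
      have h := (Finset.mem_filter.1 hn).2
      have h' : n + 1 ≤ J := by omega
      rw [← hpow, Nat.cast_sub h', abs_sub_comm, abs_of_nonneg]
      have : ((n + 1 : ℕ) : ℝ) ≤ (J : ℝ) := by exact_mod_cast h'
      linarith

lemma exponent_ineq (s σ ω : ℝ) (h1 : 2 * ω ≤ σ) (h2 : 2 * ω ≤ 2 * s - 3) (j J : ℕ) :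
    j * σ - (σ + (2 * s - 3) - ω) * (j + ((J - j : ℕ) : ℝ)) - ω * J + ω * ((J - j : ℕ) : ℝ) - J ≤
      -(2 * s - 2) * J - ω * |(j : ℝ) - J| := by
  rcases le_total J j with h | h
  · have hr : (J : ℝ) ≤ j := by exact_mod_cast h
    rw [Nat.sub_eq_zero_of_le h, abs_of_nonneg (by linarith)]
    push_cast
    nlinarith [mul_nonneg (sub_nonneg.2 h2) (sub_nonneg.2 hr)]
  · have hr : (j : ℝ) ≤ J := by exact_mod_cast h
    rw [Nat.cast_sub h, abs_sub_comm, abs_of_nonneg (by linarith)]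
    nlinarith [mul_nonneg (sub_nonneg.2 h1) (sub_nonneg.2 hr)]

lemma main_estimate (s r A : ℝ) (hs₁ : 3 / 2 < s) (hs₂ : s < 2) (hr0 : 0 < r) (hr : r < s / (s - 1))
    (hBH : BH s r A) : ∃ (C : ℝ) (K₀ : ℝ≥0∞), 0 < C ∧ K₀ ≠ ⊤ ∧
    ∀ (Ω : Set (ℝ × ℝ)) (K J : ℕ), Hyp Ω K J → ∀ Ω' ⊆ Ω, MeasurableSet Ω' → ∀ x : ℝ,
      (∀ m₁ m₂, volume (Ω' ∩ tl (2 ^ J) (2 ^ K) m₁ m₂) ≤ e2 (x * C - J - K)) →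
      eLpNorm (extOp (chi Ω')) (ENNReal.ofReal (2 * s)) volume ≤
        K₀ * (e2 x * volume Ω ^ (1 - 1 / s)) := by
  have hs0 : 0 < s := by linarith
  set σ := 2 * s / r - 2 * (s - 1) with hσ
  have hσ0 : 0 < σ := by
    have : r * (s - 1) < s := by rwa [lt_div_iff₀ (by linarith)] at hr
    rw [hσ, sub_pos, lt_div_iff₀ hr0]; nlinarith
  have hp : 2 * s / r - 1 = σ + (2 * s - 3) := by rw [hσ]; ring
  set ω := min σ (2 * s - 3) / 2 with hω
  have hω0 : 0 < ω := by rw [hω]; exact half_pos (lt_min hσ0 (by linarith))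
  have hω1 : 2 * ω ≤ σ := by rw [hω]; linarith [min_le_left σ (2 * s - 3)]
  have hω2 : 2 * ω ≤ 2 * s - 3 := by rw [hω]; linarith [min_le_right σ (2 * s - 3)]
  obtain ⟨K₁, hK₁, hsc⟩ := scaled_bound s r A (by linarith) hs₂ hr0 (by linarith) hBH
  obtain ⟨G, hG, hgeo⟩ := geom_two_sided (ω / s) (by positivity)
  set p := σ + (2 * s - 3) with hpdef
  set K₂ : ℝ≥0∞ := (K₁ * e2 (2 * (p - ω) + 2)) ^ (1 / s) with hK₂
  have hK₂t : K₂ ≠ ⊤ := ENNReal.rpow_ne_top_of_nonneg (by positivity) (ENNReal.mul_ne_top hK₁ (e2_ne_top _))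
  refine ⟨2 * s / ω, (K₂ * (G * G)) ^ (1 / 2 : ℝ) * e2 (2 * (1 - 1 / s)), by positivity,
    ENNReal.mul_ne_top (ENNReal.rpow_ne_top_of_nonneg (by positivity) (ENNReal.mul_ne_top hK₂t (ENNReal.mul_ne_top hG hG))) (e2_ne_top _), ?_⟩
  intro Ω K J hyp Ω' hsub hm x hx
  have hsub' := hsub.trans hyp.sub
  -- the bound for one pair of scales
  have hone : ∀ j k : ℕ, eLpNorm (GG Ω' j k) (ENNReal.ofReal s) volume ≤
      K₂ * e2 (2 * x - (2 * s - 2) / s * (J + K)) *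
        (e2 (-(ω / s) * |(j : ℝ) - J|) * e2 (-(ω / s) * |(k : ℝ) - K|)) := by
    intro j k
    set X := e2 (2 - (j : ℝ) - ((J - j : ℕ) : ℝ) - (k : ℝ) - ((K - k : ℕ) : ℝ)) with hX
    set Y := e2 (((J - j : ℕ) : ℝ) + ((K - k : ℕ) : ℝ) + (x * (2 * s / ω) - J - K)) with hY
    have hMX : ∀ m₁ m₂, volume (Ω' ∩ tl (2 ^ j) (2 ^ k) m₁ m₂) ≤ min X Y := by
      intro m₁ m₂
      refine le_min ((measure_mono (inter_subset_inter_left _ hsub)).trans (hyp.tile_hi j k m₁ m₂)) ?_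
      rw [hY, e2_add]
      exact tl_cover_bound Ω' j k J K _ hx m₁ m₂
    have h1 := hsc Ω' hm (2 ^ j) (2 ^ k) (by positivity) (by positivity) (whP j ×ˢ whP k) ?_ (min X Y) hMX
    swap
    · intro i hi
      rw [Finset.mem_product] at hi
      have a := (Finset.mem_filter.1 hi.1).2
      have b := (Finset.mem_filter.1 hi.2).2
      exact ⟨a.1, Wh_le a, b.1, Wh_le b⟩
    have hvol : volume Ω' ≤ e2 (-(J : ℝ) - (K : ℝ) + 2) := (measure_mono hsub).trans hyp.vol_hi
    have hminp : (min X Y) ^ p ≤ X ^ (p - ω) * Y ^ ω := by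
      calc (min X Y) ^ p = (min X Y) ^ (p - ω) * (min X Y) ^ ω := by
            rw [← ENNReal.rpow_add_of_nonneg _ _ (by linarith) hω0.le]; ring_nf
        _ ≤ _ := mul_le_mul' (ENNReal.rpow_le_rpow (min_le_left _ _) (by linarith))
            (ENNReal.rpow_le_rpow (min_le_right _ _) hω0.le)
    rw [hp, ← hσ] at h1
    have h2 : ∫⁻ q, ‖GG Ω' j k q‖ₑ ^ s ≤ K₁ * e2 (2 * (p - ω) + 2) *
        e2 (2 * s * x - (2 * s - 2) * (J + K) - ω * |(j : ℝ) - J| - ω * |(k : ℝ) - K|) := by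
      refine h1.trans ?_
      rw [mul_assoc]
      refine mul_le_mul_right ?_ _
      calc _ ≤ e2 ((j + k) * σ) * ((X ^ (p - ω) * Y ^ ω) * e2 (-(J : ℝ) - (K : ℝ) + 2)) := by
            refine mul_le_mul' (le_of_eq ?_) (mul_le_mul' hminp hvol)
            rw [ENNReal.ofReal_mul (by positivity), ofReal_two_pow, ofReal_two_pow, ← e2_add, e2_rpow]
        _ ≤ _ := by
            rw [hX, hY, e2_rpow, e2_rpow, ← e2_add, ← e2_add, ← e2_add, ← e2_add]
            apply e2_mono
            have i1 := exponent_ineq s σ ω hω1 hω2 j J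
            have i2 := exponent_ineq s σ ω hω1 hω2 k K
            have i3 : x * (2 * s / ω) * ω = 2 * s * x := by field_simp
            rw [hpdef]
            linarith
    have h3 := ENNReal.rpow_le_rpow h2 (by positivity : 0 ≤ 1 / s)
    rw [← eLpNorm_rpow_eq _ hs0, ← ENNReal.rpow_mul, mul_one_div_cancel hs0.ne', ENNReal.rpow_one,
      ENNReal.mul_rpow_of_nonneg _ _ (by positivity), e2_rpow] at h3
    refine h3.trans (le_of_eq ?_)
    rw [← e2_add, mul_assoc K₂, ← e2_add]
    congr 2
    field_simp
    ring
  -- summation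
  have hsq := whitney_bound hm hsub' (by linarith : 1 ≤ s)
    (K₂ * e2 (2 * x - (2 * s - 2) / s * (J + K)) * (G * G)) ?_
  swap
  · intro N
    refine (Finset.sum_le_sum fun i _ => hone (i.1 + 1) (i.2 + 1)).trans ?_
    rw [← Finset.mul_sum, Finset.sum_product]
    dsimp only
    rw [← Finset.sum_mul_sum]
    exact mul_le_mul_right (mul_le_mul' (hgeo N J) (hgeo N K)) _
  have h4 := ENNReal.rpow_le_rpow hsq (by norm_num : (0 : ℝ) ≤ 1 / 2)
  rw [← ENNReal.rpow_mul, mul_one_div_cancel (by norm_num), ENNReal.rpow_one] at h4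
  refine h4.trans ?_
  have h5 : e2 (-(1 - 1 / s) * (J + K)) ≤ e2 (2 * (1 - 1 / s)) * volume Ω ^ (1 - 1 / s) := by
    have hs' : 0 ≤ 1 - 1 / s := by
      rw [sub_nonneg, div_le_one hs0]; linarith
    calc e2 (-(1 - 1 / s) * (J + K)) = e2 (2 * (1 - 1 / s)) * e2 (-(J : ℝ) - K - 2) ^ (1 - 1 / s) := by
          rw [e2_rpow, ← e2_add]; congr 1; ring
      _ ≤ _ := mul_le_mul_right (ENNReal.rpow_le_rpow hyp.vol_lo hs') _
  calc _ = (K₂ * (G * G)) ^ (1 / 2 : ℝ) * (e2 x * e2 (-(1 - 1 / s) * (J + K))) := by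
        rw [mul_right_comm, ENNReal.mul_rpow_of_nonneg _ _ (by norm_num), e2_rpow, ← e2_add]
        congr 2
        field_simp
        ring
    _ ≤ (K₂ * (G * G)) ^ (1 / 2 : ℝ) * (e2 x * (e2 (2 * (1 - 1 / s)) * volume Ω ^ (1 - 1 / s))) :=
        mul_le_mul_right (mul_le_mul_right h5 _) _
    _ = _ := by ring

open MeasureTheory Set
open scoped ENNReal

lemma tl_sub_tile (J K : ℕ) (m₁ m₂ : ℤ) : tl (2 ^ J) (2 ^ K) m₁ m₂ ⊆ tile (J : ℤ) (K : ℤ) m₁ m₂ := by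
  have key : ∀ (n : ℕ) (m : ℤ) (x : ℝ), ⌊(2 : ℝ) ^ n * x⌋ = m → x ∈ dyadicIcc (n : ℤ) m := by
    intro n m x hx
    have h := Int.floor_eq_iff.1 hx
    have hpos : (0 : ℝ) < 2 ^ n := by positivity
    unfold dyadicIcc
    rw [zpow_neg, zpow_natCast, ← div_eq_mul_inv, ← div_eq_mul_inv]
    constructor
    · rw [div_le_iff₀ hpos]; linarith [h.1]
    · rw [le_div_iff₀ hpos]; linarith [h.2]
  rintro ξ ⟨h1, h2⟩
  exact ⟨key J m₁ ξ.1 h1, key K m₂ ξ.2 h2⟩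

lemma tl_sum_le (B : Set (ℝ × ℝ)) (hB : MeasurableSet B) (a b : ℝ) (T : Finset (ℤ × ℤ)) :
    ∑ m ∈ T, volume (B ∩ tl a b m.1 m.2) ≤ volume B := by
  rw [← measure_biUnion_finset]
  · exact measure_mono (iUnion₂_subset fun _ _ => inter_subset_left)
  · intro m _ n _ hmn
    refine Set.disjoint_left.2 fun ξ h1 h2 => hmn ?_
    exact Prod.ext (h1.2.1.symm.trans h2.2.1) (h1.2.2.symm.trans h2.2.2)
  · intro m _; exact hB.inter (tl_meas _ _ _ _)

lemma BH_one {s r A : ℝ} (hr : r ≤ 0) (h : BH s r A) : BH s 1 A := by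
  intro a₁ a₂ b₁ b₂ h1 h2 h3 h4 f g hf hg
  have := h a₁ a₂ b₁ b₂ h1 h2 h3 h4 f g hf hg
  rw [ENNReal.ofReal_of_nonpos hr] at this
  simp only [eLpNorm_exponent_zero, mul_zero] at this
  exact this.trans zero_le

theorem assembly (s C : ℝ) (K₀ : ℝ≥0∞) (hC : 0 < C) (hK₀ : K₀ ≠ ⊤)
    (hmain : ∀ (Ω : Set (ℝ × ℝ)) (K J : ℕ), Hyp Ω K J → ∀ Ω' ⊆ Ω, MeasurableSet Ω' → ∀ x : ℝ,
      (∀ m₁ m₂, volume (Ω' ∩ tl (2 ^ J) (2 ^ K) m₁ m₂) ≤ e2 (x * C - J - K)) →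
      eLpNorm (extOp (chi Ω')) (ENNReal.ofReal (2 * s)) volume ≤
        K₀ * (e2 x * volume Ω ^ (1 - 1 / s)))
    (Ω : Set (ℝ × ℝ)) (K J : ℕ) (N : ℤ) (hyp : Hyp Ω K J) (hV : VargasBound s Ω (2 ^ N)) :
    ∃ F : ℤ → Set (ℝ × ℝ),
      (∀ n : ℤ, MeasurableSet (F n)) ∧
      Ω = ⋃ n ∈ {n : ℤ | (2 : ℝ) ^ n ≤ (2 : ℝ) ^ N}, F n ∧
      ∀ n : ℤ, (2 : ℝ) ^ n ≤ (2 : ℝ) ^ N →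
        (∃ T : Finset (ℤ × ℤ), (T.card : ℝ) ≤ (1 + 4 * 2 ^ C + K₀.toReal) * ((2 : ℝ) ^ n) ^ (-C) ∧
          F n ⊆ ⋃ p ∈ T, tile (J : ℤ) (K : ℤ) p.1 p.2) ∧
        ∀ Ω' ⊆ F n, MeasurableSet Ω' →
          eLpNorm (extOp (chi Ω')) (ENNReal.ofReal (2 * s)) volume ≤
            ENNReal.ofReal ((1 + 4 * 2 ^ C + K₀.toReal) * 2 ^ n) * volume Ω ^ (1 - 1 / s) := by
  classical
  set idx : ℝ × ℝ → ℤ × ℤ := fun ξ => (⌊(2 : ℝ) ^ J * ξ.1⌋, ⌊(2 : ℝ) ^ K * ξ.2⌋) with hidx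
  have hidxm : Measurable idx := by fun_prop
  set I : Finset (ℤ × ℤ) := Finset.Icc 0 (2 ^ J) ×ˢ Finset.Icc 0 (2 ^ K) with hI
  have hidxI : ∀ ξ ∈ Ω, idx ξ ∈ I := by
    intro ξ hξ
    have h := hyp.sub hξ
    exact Finset.mem_product.2 ⟨Finset.mem_Icc.2 (floor_range J h.1), Finset.mem_Icc.2 (floor_range K h.2)⟩
  set G : ℤ → Finset (ℤ × ℤ) := fun n =>
    I.filter fun p => e2 (n * C - J - K) ≤ volume (Ω ∩ tl (2 ^ J) (2 ^ K) p.1 p.2) with hG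
  have hpw : ∀ n : ℤ, ((2 : ℝ) ^ n) ^ (-C) = 2 ^ (-(n * C)) := by
    intro n
    rw [← Real.rpow_intCast, ← Real.rpow_mul (by norm_num)]; congr 1; ring
  have hGcard : ∀ n : ℤ, ((G n).card : ℝ) ≤ 2 ^ (2 - n * C) := by
    intro n
    have h1 : ((G n).card : ℝ≥0∞) * e2 (n * C - J - K) ≤ e2 (-J - K + 2) := by
      calc _ = ∑ p ∈ G n, e2 (n * C - J - K) := by rw [Finset.sum_const, nsmul_eq_mul]
        _ ≤ ∑ p ∈ G n, volume (Ω ∩ tl (2 ^ J) (2 ^ K) p.1 p.2) :=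
            Finset.sum_le_sum fun p hp => (Finset.mem_filter.1 hp).2
        _ ≤ volume Ω := tl_sum_le _ hyp.meas _ _ _
        _ ≤ _ := hyp.vol_hi
    have h2 : ((G n).card : ℝ≥0∞) ≤ e2 (2 - n * C) := by
      have := mul_le_mul_left h1 (e2 (-(n * C - J - K)))
      rw [mul_assoc, ← e2_add, ← e2_add, add_neg_cancel, e2_zero, mul_one] at this
      refine this.trans (e2_mono (by linarith))
    rw [← e2_ofReal, ← ENNReal.ofReal_natCast] at h2
    exact (ENNReal.ofReal_le_ofReal_iff (by positivity)).1 h2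
  obtain ⟨n0, hn0N, hn0⟩ : ∃ n0 : ℤ, n0 < N ∧ (I.card : ℝ) ≤ 2 ^ (-(n0 * C)) := by
    obtain ⟨M, hM⟩ := exists_nat_gt ((I.card : ℝ) / C)
    refine ⟨min (N - 1) (-M), by omega, ?_⟩
    have h1 : (I.card : ℝ) ≤ M * C := ((div_lt_iff₀ hC).1 hM).le
    have h2 : (((min (N - 1) (-M) : ℤ)) : ℝ) ≤ -M := by exact_mod_cast min_le_right _ _
    have h3 : (I.card : ℝ) ≤ -(((min (N - 1) (-M) : ℤ) : ℝ) * C) := by nlinarith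
    calc (I.card : ℝ) ≤ (2 : ℝ) ^ (I.card : ℝ) := by
          rw [Real.rpow_natCast]; exact_mod_cast (Nat.lt_two_pow_self).le
      _ ≤ _ := Real.rpow_le_rpow_of_exponent_le (by norm_num) h3
  set P : ℤ → ℤ × ℤ → Prop := fun n p =>
    n ≤ N ∧ (n = N ∨ p ∉ G n) ∧ n0 ≤ n ∧ (n = n0 ∨ p ∈ G (n - 1)) with hP
  refine ⟨fun n => Ω ∩ idx ⁻¹' {p | P n p}, fun n => hyp.meas.inter (hidxm (MeasurableSet.of_discrete)), ?_, ?_⟩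
  · ext ξ
    simp only [mem_iUnion, mem_setOf_eq, exists_prop]
    constructor
    · intro hξ
      have hex : ∃ k : ℕ, n0 + (k : ℤ) = N ∨ idx ξ ∉ G (n0 + k) :=
        ⟨(N - n0).toNat, Or.inl (by omega)⟩
      have hspec := Nat.find_spec hex
      have hmin := fun m => Nat.find_min hex (m := m)
      have hle : Nat.find hex ≤ (N - n0).toNat := Nat.find_min' hex (Or.inl (by omega))
      set k := Nat.find hex
      have hkN : n0 + (k : ℤ) ≤ N := by omega
      refine ⟨n0 + k, zpow_le_zpow_right₀ (by norm_num) hkN, hξ, hkN, hspec, by omega, ?_⟩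
      rcases Nat.eq_zero_or_pos k with h0 | h0
      · left; omega
      · right
        have := hmin (k - 1) (by omega)
        push Not at this
        have h3 := this.2
        have h4 : n0 + ((k - 1 : ℕ) : ℤ) = n0 + k - 1 := by omega
        rwa [h4] at h3
    · rintro ⟨n, -, h, -⟩; exact h
  · intro n _
    have hCp : (0 : ℝ) < 2 ^ C := by positivity
    have hKr : 0 ≤ K₀.toReal := ENNReal.toReal_nonneg
    constructor
    · refine ⟨if n = n0 then I else G (n - 1), ?_, ?_⟩
      · rw [hpw]
        have hpos : (0 : ℝ) < 2 ^ (-(n * C)) := by positivity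
        split_ifs with h
        · subst h
          refine hn0.trans ?_
          nlinarith
        · refine (hGcard _).trans ?_
          have : (2 : ℝ) ^ (2 - ((n - 1 : ℤ) : ℝ) * C) = 4 * 2 ^ C * 2 ^ (-(n * C)) := by
            have h4 : (4 : ℝ) = 2 ^ (2 : ℝ) := by rw [Real.rpow_two]; norm_num
            rw [h4, ← Real.rpow_add (by norm_num), ← Real.rpow_add (by norm_num)]
            congr 1; push_cast; ring
          rw [this]
          nlinarith
      · rintro ξ ⟨hξ, -, -, -, h⟩
        refine mem_iUnion₂.2 ⟨idx ξ, ?_, tl_sub_tile J K _ _ ⟨rfl, rfl⟩⟩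
        split_ifs with h'
        · exact hidxI ξ hξ
        · exact h.resolve_left h'
    · intro Ω' hΩ' hm
      have hsub : Ω' ⊆ Ω := hΩ'.trans inter_subset_left
      have h2n : (0 : ℝ) < 2 ^ n := by positivity
      by_cases hn : n = N
      · subst hn
        refine (hV Ω' hsub hm).trans (mul_le_mul_left (ENNReal.ofReal_le_ofReal ?_) _)
        nlinarith
      · refine (hmain Ω K J hyp Ω' hsub hm n ?_).trans ?_
        · intro m₁ m₂
          rcases (Ω' ∩ tl (2 ^ J) (2 ^ K) m₁ m₂).eq_empty_or_nonempty with h0 | ⟨ξ, hξ, h1, h2⟩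
          · rw [h0]; simp
          · have h3 := (hΩ' hξ).2.2.1.resolve_left hn
            have h4 : idx ξ = (m₁, m₂) := Prod.ext h1 h2
            have h5 := hidxI ξ (hsub hξ)
            rw [h4] at h3 h5
            have h6 : ¬ e2 (n * C - J - K) ≤ volume (Ω ∩ tl (2 ^ J) (2 ^ K) m₁ m₂) :=
              fun h => h3 (Finset.mem_filter.2 ⟨h5, h⟩)
            exact (measure_mono (inter_subset_inter_left _ hsub)).trans (not_le.1 h6).le
        · rw [← mul_assoc]
          refine mul_le_mul_left ?_ _
          rw [ENNReal.ofReal_mul (by positivity)]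
          refine mul_le_mul' ?_ ?_
          · rw [← ENNReal.ofReal_toReal hK₀]
            apply ENNReal.ofReal_le_ofReal
            rw [ENNReal.toReal_ofReal hKr]
            nlinarith
          · rw [← e2_ofReal, Real.rpow_intCast]

open MeasureTheory Set
open scoped ENNReal

/-- structure of near-extremizers of Vargas's estimate: under BH(s,r) with
`3/2 < s < 2`, `r < s'`, there are admissible constants `C, C' > 0` such that the following
holds.  Let `Ω ⊆ [0,1]²` be measurable with `Ω = Ω(K)` (every nonempty vertical fiber has
measure in `[2^{-K-1}, 2^{-K+1}]`), let `J ≥ 0` satisfy `2^{-J-1} ≤ |π₁(Ω)| ≤ 2^{-J+1}`, and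
let `ε` be the smallest dyadic number such that `∥𝓔χ_{Ω'}∥_{2s} ≤ ε|Ω|^{1/s'}` for every
measurable `Ω' ⊆ Ω`.  Then `Ω = ⋃_{0 < δ ≤ ε dyadic} Ω_δ` where each `Ω_δ` (with `δ = 2ⁿ`)
is contained in a union of at most `C'·δ^{-C}` tiles of `𝓓_{J,K}` and satisfies
`∥𝓔χ_{Ω'}∥_{2s} ≤ C'·δ·|Ω|^{1/s'}` for every measurable `Ω' ⊆ Ω_δ`. -/
theorem stmt5 (s r A : ℝ) (hs₁ : 3 / 2 < s) (hs₂ : s < 2) (hr : r < s / (s - 1))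
    (hBH : BH s r A) :
    ∃ C C' : ℝ, 0 < C ∧ 0 < C' ∧
      ∀ (Ω : Set (ℝ × ℝ)) (K J : ℕ) (ε : ℝ),
        MeasurableSet Ω → Ω ⊆ Icc 0 1 ×ˢ Icc 0 1 →
        (∀ x : ℝ, (vFiber Ω x).Nonempty →
          (2 : ℝ≥0∞) ^ (-(K : ℤ) - 1) ≤ volume (vFiber Ω x) ∧
            volume (vFiber Ω x) ≤ (2 : ℝ≥0∞) ^ (-(K : ℤ) + 1)) →
        (2 : ℝ≥0∞) ^ (-(J : ℤ) - 1) ≤ volume (Prod.fst '' Ω) →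
        volume (Prod.fst '' Ω) ≤ (2 : ℝ≥0∞) ^ (-(J : ℤ) + 1) →
        IsDyadic ε → VargasBound s Ω ε →
        (∀ ε' : ℝ, IsDyadic ε' → ε' < ε → ¬ VargasBound s Ω ε') →
        ∃ F : ℤ → Set (ℝ × ℝ),
          (∀ n : ℤ, MeasurableSet (F n)) ∧
          Ω = ⋃ n ∈ {n : ℤ | (2 : ℝ) ^ n ≤ ε}, F n ∧
          ∀ n : ℤ, (2 : ℝ) ^ n ≤ ε →
            (∃ T : Finset (ℤ × ℤ), (T.card : ℝ) ≤ C' * ((2 : ℝ) ^ n) ^ (-C) ∧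
              F n ⊆ ⋃ p ∈ T, tile (J : ℤ) (K : ℤ) p.1 p.2) ∧
            ∀ Ω' ⊆ F n, MeasurableSet Ω' →
              eLpNorm (extOp (chi Ω')) (ENNReal.ofReal (2 * s)) volume ≤
                ENNReal.ofReal (C' * 2 ^ n) * volume Ω ^ (1 - 1 / s) := by
  obtain ⟨r', hr0, hr', hBH'⟩ : ∃ r' : ℝ, 0 < r' ∧ r' < s / (s - 1) ∧ BH s r' A := by
    rcases le_or_gt r 0 with h | h
    · refine ⟨1, one_pos, ?_, BH_one h hBH⟩
      rw [lt_div_iff₀ (by linarith)]; linarith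
    · exact ⟨r, h, hr, hBH⟩
  obtain ⟨C, K₀, hC, hK₀, hmain⟩ := main_estimate s r' A hs₁ hs₂ hr0 hr' hBH'
  have hKr : 0 ≤ K₀.toReal := ENNReal.toReal_nonneg
  refine ⟨C, 1 + 4 * 2 ^ C + K₀.toReal, hC, by positivity, ?_⟩
  rintro Ω K J ε h1 h2 h3 h4 h5 ⟨N, rfl⟩ hV -
  exact assembly s C K₀ hC hK₀ hmain Ω K J N ⟨h1, h2, h3, h4, h5⟩ hV
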